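/- arXiv:1203.2484 — 2 statements merged into one kernel-verified Lean document; each statement's English description precedes it below -/
import Mathlib

section
/- (Hironaka) Let (R,M,k) be a regular local ring with regular system of parameters (y,u_1,...,u_d) and f ∈ M with f ∉ (u_1,...,u_d). Then there exists ŷ in the M-adic completion R̂ such that (ŷ,u_1,...,u_d) is a regular system of parameters of R̂ and Δ(f;u_1,...,u_d;ŷ) = Δ(f;u_1,...,u_d). In particular, the characteristic polyhedron Δ(f;u_1,...,u_d) is a rational polyhedron. -/
/-!
Characteristic polyhedra of singularities without completion
(V. Cossart, O. Piltant), formalized statements.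
-/

noncomputable section

open IsLocalRing TensorProduct

namespace CharPolyhedra

universe u v

/-! ### Polyhedral notions -/

/-- The nonnegative orthant in `ℝ^d`. -/
def orthant (d : ℕ) : Set (Fin d → ℝ) := {x | ∀ i, 0 ≤ x i}

/-- An `F`-subset of `ℝ_{≥0}^d`: a closed convex subset stable under translation
by the nonnegative orthant. -/
def IsFSubset {d : ℕ} (Δ : Set (Fin d → ℝ)) : Prop :=
  Δ ⊆ orthant d ∧ IsClosed Δ ∧ Convex ℝ Δ ∧ ∀ v ∈ Δ, ∀ w ∈ orthant d, v + w ∈ Δ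

/-- The smallest `F`-subset containing a given set of points. -/
def smallestFSubset {d : ℕ} (X : Set (Fin d → ℝ)) : Set (Fin d → ℝ) :=
  ⋂₀ {Δ | IsFSubset Δ ∧ X ⊆ Δ}

/-- A vertex of an `F`-subset: a point cut out by a positive linear form. -/
def IsVertex {d : ℕ} (Δ : Set (Fin d → ℝ)) (v : Fin d → ℝ) : Prop :=
  ∃ L : Fin d → ℝ, (∀ i, 0 < L i) ∧ Δ ∩ {x | ∑ i, L i * x i = 1} = {v}

/-- A rational polyhedron: an `F`-subset cut out by finitely many nonnegative
rational linear forms. -/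
def IsRationalPolyhedron {d : ℕ} (Δ : Set (Fin d → ℝ)) : Prop :=
  ∃ (n : ℕ) (L : Fin n → Fin d → ℚ), (∀ j i, 0 ≤ L j i) ∧
    Δ = {x | x ∈ orthant d ∧ ∀ j, 1 ≤ ∑ i, (L j i : ℝ) * x i}

/-- `min {L(a) : a ∈ Δ}` for a linear form with rational coefficients `L`. -/
def ellOf {d : ℕ} (L : Fin d → ℚ) (Δ : Set (Fin d → ℝ)) : ℝ :=
  sInf ((fun x => ∑ i, (L i : ℝ) * x i) '' Δ)

/-! ### Regular local rings, systems of parameters -/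

/-- A family `s` of `n` elements is a regular system of parameters of the local
ring `R`: it generates the maximal ideal and `n` equals the Krull dimension. -/
def IsSysOfParams (R : Type u) [CommRing R] [IsLocalRing R] {n : ℕ} (s : Fin n → R) : Prop :=
  Ideal.span (Set.range s) = maximalIdeal R ∧ ringKrullDim R = n

/-- `(y, u 0, ..., u (d-1))` is a regular system of parameters of `R`. -/
def IsRSP (R : Type u) [CommRing R] [IsLocalRing R] {d : ℕ} (y : R) (u : Fin d → R) : Prop :=
  IsSysOfParams R (Fin.cons y u)

/-- A regular local ring: a Noetherian local ring whose maximal ideal is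
generated by a regular system of parameters. -/
def IsRegularLocalRing (R : Type u) [CommRing R] [IsLocalRing R] : Prop :=
  IsNoetherianRing R ∧ ∃ (n : ℕ) (s : Fin n → R), IsSysOfParams R s

/-- A regular ring: a Noetherian ring all of whose localizations at primes are
regular local rings. -/
def IsRegularRing (A : Type u) [CommRing A] : Prop :=
  IsNoetherianRing A ∧ ∀ (P : Ideal A) [P.IsPrime],
    IsRegularLocalRing (Localization.AtPrime P)

/-! ### Monomial expansions and polyhedra -/

variable {R : Type u} [CommRing R]

/-- The monomial `y^b u^a`, where `ab = (a, b)`. -/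
def monomial {d : ℕ} (y : R) (u : Fin d → R) (ab : (Fin d → ℕ) × ℕ) : R :=
  y ^ ab.2 * ∏ i, u i ^ ab.1 i

/-- A finite expansion `f = Σ_{(a,b)} C_{a,b} y^b u^a` with all coefficients units. -/
def IsUnitExpansion {d : ℕ} (f y : R) (u : Fin d → R)
    (c : ((Fin d → ℕ) × ℕ) →₀ R) : Prop :=
  (∀ ab ∈ c.support, IsUnit (c ab)) ∧ f = c.sum fun ab r => r * monomial y u ab

/-- The projection `(a, b) ↦ a / (m - b)` from the point `(0, m)`. -/
def projPoint {d : ℕ} (m : ℕ) (ab : (Fin d → ℕ) × ℕ) : Fin d → ℝ :=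
  fun i => (ab.1 i : ℝ) / ((m : ℝ) - (ab.2 : ℝ))

/-- The projected points attached to (the support of) an expansion. -/
def expPoints {d : ℕ} (m : ℕ) (s : Finset ((Fin d → ℕ) × ℕ)) : Set (Fin d → ℝ) :=
  {x | ∃ ab ∈ s, ab.2 < m ∧ x = projPoint m ab}

/-- The polyhedron `Δ(f; u; y)` computed with prescribed order `m`: the smallest
`F`-subset containing the projected supports of all finite unit-coefficient
expansions of `f` in the parameters `(y, u)`. -/
def DeltaOf {d : ℕ} (f y : R) (u : Fin d → R) (m : ℕ) : Set (Fin d → ℝ) :=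
  smallestFSubset (⋃ c ∈ {c | IsUnitExpansion f y u c}, expPoints m c.support)

/-- The order of the image of `f` in `R/(u_1, ..., u_d)`, i.e. the largest `n`
with `f ∈ M^n + (u_1, ..., u_d)`. -/
def ordRes {d : ℕ} [IsLocalRing R] (f : R) (u : Fin d → R) : ℕ :=
  sSup {n : ℕ | f ∈ (maximalIdeal R) ^ n ⊔ Ideal.span (Set.range u)}

/-- Hironaka's polyhedron `Δ(f; u_1, ..., u_d; y)`. -/
def Delta {d : ℕ} [IsLocalRing R] (f y : R) (u : Fin d → R) : Set (Fin d → ℝ) :=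
  DeltaOf f y u (ordRes f u)

/-! ### Completion and the characteristic polyhedron -/

/-- The `M`-adic completion `R̂` of a local ring `R`. -/
abbrev Completion (R : Type u) [CommRing R] [IsLocalRing R] : Type u :=
  AdicCompletion (maximalIdeal R) R

/-- The canonical map `R → R̂`. -/
def cmpl {R : Type u} [CommRing R] [IsLocalRing R] : R →+* Completion R :=
  algebraMap R (Completion R)

/-- `(ŷ, u_1, ..., u_d)` is a regular system of parameters of the completion
`R̂`: it generates the maximal ideal `M·R̂` of `R̂`. -/
def IsRSPhat (R : Type u) [CommRing R] [IsLocalRing R] {d : ℕ}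
    (yh : Completion R) (u : Fin d → R) : Prop :=
  Ideal.span (insert yh (Set.range fun i => cmpl (u i)))
    = (maximalIdeal R).map (cmpl (R := R))

/-- Hironaka's characteristic polyhedron `Δ(f; u_1, ..., u_d)`: the intersection
of the `Δ(f; u; ŷ)` over all regular systems of parameters `(ŷ, u_1, ..., u_d)`
of the completion `R̂`. -/
def CharPolyhedron {d : ℕ} [IsLocalRing R] (f : R) (u : Fin d → R) : Set (Fin d → ℝ) :=
  ⋂ yh ∈ {yh : Completion R | IsRSPhat R yh u},
    DeltaOf (cmpl f) yh (fun i => cmpl (u i)) (ordRes f u)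

/-! ### G-rings, excellence -/

/-- A `κ`-algebra `A` is geometrically regular if `κ' ⊗[κ] A` is a regular ring
for every finite field extension `κ'/κ`. -/
def IsGeometricallyRegularAlgebra (κ : Type u) [Field κ] (A : Type v) [CommRing A]
    [Algebra κ A] : Prop :=
  ∀ (κ' : Type u) [Field κ'] [Algebra κ κ'] [Module.Finite κ κ'],
    IsRegularRing (κ' ⊗[κ] A)

/-- A local ring has geometrically regular formal fibers if, for every prime
`P ⊂ R`, the formal fiber `κ(P) ⊗_R R̂` is a geometrically regular
`κ(P)`-algebra. -/
def HasGeomRegularFormalFibers (R : Type u) [CommRing R] [IsLocalRing R] : Prop :=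
  ∀ (P : Ideal R) [P.IsPrime],
    IsGeometricallyRegularAlgebra (ResidueField (Localization.AtPrime P))
      (ResidueField (Localization.AtPrime P) ⊗[R] Completion R)

/-- A G-ring: a Noetherian ring all of whose localizations at primes have
geometrically regular formal fibers. -/
def IsGRing (A : Type u) [CommRing A] : Prop :=
  IsNoetherianRing A ∧ ∀ (P : Ideal A) [P.IsPrime],
    HasGeomRegularFormalFibers (Localization.AtPrime P)

/-- A saturated chain of primes: each step is a covering relation. -/
def IsSaturatedChain {A : Type u} [CommRing A] (c : LTSeries (PrimeSpectrum A)) : Prop :=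
  ∀ i : Fin c.length, c.toFun i.castSucc ⋖ c.toFun i.succ

/-- A catenary ring: any two saturated chains of primes with the same endpoints
have the same length. -/
def IsCatenary (A : Type u) [CommRing A] : Prop :=
  ∀ (c₁ c₂ : LTSeries (PrimeSpectrum A)), c₁.head = c₂.head → c₁.last = c₂.last →
    IsSaturatedChain c₁ → IsSaturatedChain c₂ → c₁.length = c₂.length

/-- Universally catenary: all polynomial rings over `A` are catenary. -/
def IsUniversallyCatenary (A : Type u) [CommRing A] : Prop :=
  ∀ n : ℕ, IsCatenary (MvPolynomial (Fin n) A)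

/-- The regular locus of any domain finite over `A` is open. -/
def HasOpenRegularLocus (A : Type u) [CommRing A] : Prop :=
  ∀ (B : Type u) [CommRing B] [IsDomain B] [Algebra A B] [Module.Finite A B],
    IsOpen {P : PrimeSpectrum B | IsRegularLocalRing (Localization.AtPrime P.asIdeal)}

/-- Quasi-excellent: a G-ring with open regular loci for finite domains over it. -/
def IsQuasiExcellent (A : Type u) [CommRing A] : Prop :=
  IsGRing A ∧ HasOpenRegularLocus A

/-- Excellent: universally catenary and quasi-excellent. -/
def IsExcellent (A : Type u) [CommRing A] : Prop :=
  IsUniversallyCatenary A ∧ IsQuasiExcellent A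

/-! ### Monomial valuations and associated graded rings -/

/-- The weight `l·b + L(a)` of the monomial `y^b u^a`. -/
def weight {d : ℕ} (l : ℝ) (L : Fin d → ℝ) (ab : (Fin d → ℕ) × ℕ) : ℝ :=
  l * (ab.2 : ℝ) + ∑ i, L i * (ab.1 i : ℝ)

/-- The ideal `I_λ` generated by the monomials `y^b u^a` with `l·b + L(a) ≥ λ`. -/
def monIdeal {d : ℕ} (y : R) (u : Fin d → R) (l : ℝ) (L : Fin d → ℝ) (lam : ℝ) :
    Ideal R :=
  Ideal.span {g | ∃ ab : (Fin d → ℕ) × ℕ, g = monomial y u ab ∧ lam ≤ weight l L ab}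

/-- The monomial valuation `v(g) := max {λ : g ∈ I_λ}`. -/
def vval {d : ℕ} (y : R) (u : Fin d → R) (l : ℝ) (L : Fin d → ℝ) (g : R) : ℝ :=
  sSup {lam : ℝ | g ∈ monIdeal y u l L lam}

/-- The Rees algebra `⊕_λ I_λ` of the filtration `(I_λ)`, realized inside the
monoid algebra `R[ℝ]`. -/
def ReesAlgebra {d : ℕ} (y : R) (u : Fin d → R) (l : ℝ) (L : Fin d → ℝ) :
    Subalgebra R (AddMonoidAlgebra R ℝ) :=
  Algebra.adjoin R {p | ∃ (lam : ℝ) (x : R), x ∈ monIdeal y u l L lam ∧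
    p = AddMonoidAlgebra.single lam x}

/-- The ideal `⊕_λ I_{λ⁺}` of the Rees algebra. -/
def grIdeal {d : ℕ} (y : R) (u : Fin d → R) (l : ℝ) (L : Fin d → ℝ) :
    Ideal (ReesAlgebra y u l L) :=
  Ideal.span {p | ∃ (lam : ℝ) (x : R), (∃ lam' > lam, x ∈ monIdeal y u l L lam') ∧
    (p : AddMonoidAlgebra R ℝ) = AddMonoidAlgebra.single lam x}

/-- The associated graded ring `gr_v(R) = ⊕_λ I_λ / I_{λ⁺}` of `R` with respect
to the monomial valuation `v`, realized as `(⊕_λ I_λ) / (⊕_λ I_{λ⁺})`. -/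
abbrev GrRing {d : ℕ} (y : R) (u : Fin d → R) (l : ℝ) (L : Fin d → ℝ) : Type u :=
  ReesAlgebra y u l L ⧸ grIdeal y u l L

/-- `x ∈ gr_v(R)` is the initial form of `g ∈ R`: the class of `g` placed in
degree `v(g)`. -/
def IsInitialForm {d : ℕ} (y : R) (u : Fin d → R) (l : ℝ) (L : Fin d → ℝ) (g : R)
    (x : GrRing y u l L) : Prop :=
  ∃ h : AddMonoidAlgebra.single (vval y u l L g) g ∈ ReesAlgebra y u l L,
    x = Ideal.Quotient.mk (grIdeal y u l L)
      ⟨AddMonoidAlgebra.single (vval y u l L g) g, h⟩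


/-! ### Part 1: monomials in good sequences -/

/-- span of `x_i^(b_i+1)`, `i ∈ T` -/
def pw {A : Type*} [CommRing A] {ι : Type*} (x : ι → A) (T : Finset ι) (b : ι → ℕ) : Ideal A :=
  Ideal.span ((fun i => x i ^ (b i + 1)) '' (T : Set ι))

lemma pw_congr {A : Type*} [CommRing A] {ι : Type*} (x : ι → A) (T : Finset ι) (b b' : ι → ℕ)
    (h : ∀ i ∈ T, b i = b' i) : pw x T b = pw x T b' := by
  unfold pw
  congr 1
  apply Set.image_congr
  intro i hi
  rw [h i (by simpa using hi)]

lemma pw_erase {A : Type*} [CommRing A] {ι : Type*} [DecidableEq ι] (x : ι → A) (T : Finset ι)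
    (b : ι → ℕ) (i : ι) (hi : i ∈ T) :
    pw x T b = Ideal.span {x i ^ (b i + 1)} ⊔ pw x (T.erase i) b := by
  unfold pw
  rw [← Ideal.span_union]
  congr 1
  have : (T : Set ι) = insert i ((T.erase i : Finset ι) : Set ι) := by
    rw [← Finset.coe_insert, Finset.insert_erase hi]
  rw [this, Set.image_insert_eq, Set.singleton_union]

lemma mem_pw_iff {A : Type*} [CommRing A] {ι : Type*} [DecidableEq ι] (x : ι → A) (T : Finset ι)
    (b : ι → ℕ) (i : ι) (hi : i ∈ T) (r : A) :
    r ∈ pw x T b ↔ ∃ q, r - q * x i ^ (b i + 1) ∈ pw x (T.erase i) b := by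
  rw [pw_erase x T b i hi, Ideal.mem_span_singleton_sup]
  constructor
  · rintro ⟨a, c, hc, h⟩
    exact ⟨a, by rw [← h]; simpa using hc⟩
  · rintro ⟨q, h⟩
    exact ⟨q, _, h, by ring⟩

/-- good sequences -/
def GoodSeq {A : Type*} [CommRing A] {ι : Type*} (x : ι → A) : Prop :=
  ∀ (T : Finset ι) (j : ι), j ∉ T → ∀ r, x j * r ∈ Ideal.span (x '' (T : Set ι)) →
    r ∈ Ideal.span (x '' (T : Set ι))

lemma GoodSeq.nzd {A : Type*} [CommRing A] {ι : Type*} {x : ι → A} (hx : GoodSeq x) :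
    ∀ (k n : ℕ) (T : Finset ι) (b : ι → ℕ), T.card ≤ k → ∑ i ∈ T, b i ≤ n → ∀ j ∉ T, ∀ r,
      x j * r ∈ pw x T b → r ∈ pw x T b := by
  classical
  intro k
  induction k with
  | zero =>
    intro n T b hT _ j hj r hr
    have : T = ∅ := by simpa using hT
    subst this
    have := hx ∅ j hj r (by simpa [pw] using hr)
    simpa [pw] using this
  | succ k ihk =>
    intro n
    induction n with
    | zero =>
      intro T b hT hb j hj r hr
      have h0 : pw x T b = Ideal.span (x '' (T : Set ι)) := by
        rw [pw_congr x T b (fun _ => 0)]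
        · simp [pw]
        · intro i hi
          have := Finset.single_le_sum (f := b) (fun _ _ => Nat.zero_le _) hi
          omega
      rw [h0] at hr ⊢
      exact hx T j hj r hr
    | succ n ihn =>
      intro T b hT hb j hj r hr
      by_cases hz : ∑ i ∈ T, b i ≤ n
      · exact ihn T b hT hz j hj r hr
      obtain ⟨i, hi, hbi⟩ : ∃ i ∈ T, b i ≠ 0 := by
        by_contra! hcon
        rw [Finset.sum_eq_zero hcon] at hz
        omega
      have hsum : ∀ c, c < b i → ∑ l ∈ T, Function.update b i c l ≤ n := by
        intro c hc
        have := Finset.sum_update_of_mem hi b c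
        have h2 := Finset.add_sum_erase T b hi
        rw [this, ← Finset.erase_eq]
        omega
      have her : ∀ c, pw x (T.erase i) (Function.update b i c) = pw x (T.erase i) b := by
        intro c
        apply pw_congr
        intro l hl
        rw [Function.update_of_ne (Finset.ne_of_mem_erase hl)]
      have hcard : (T.erase i).card ≤ k := by
        rw [Finset.card_erase_of_mem hi]; omega
      obtain ⟨q, hq⟩ := (mem_pw_iff x T b i hi _).1 hr
      have h1 : r ∈ pw x T (Function.update b i (b i - 1)) := by
        apply ihn T _ hT (hsum _ (by omega)) j hj
        rw [mem_pw_iff _ _ _ i hi, her]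
        refine ⟨q * x i, ?_⟩
        rw [Function.update_self]
        convert hq using 2
        have : b i + 1 = (b i - 1 + 1) + 1 := by omega
        rw [this, pow_succ (x i) (b i - 1 + 1)]; ring
      obtain ⟨r', hr'⟩ := (mem_pw_iff x T _ i hi _).1 h1
      rw [her, Function.update_self] at hr'
      have h2 : x i ^ (b i) * (x j * r' - x i * q) ∈ pw x (T.erase i) b := by
        have e : b i - 1 + 1 = b i := by omega
        rw [e] at hr'
        have := Ideal.sub_mem _ hq (Ideal.mul_mem_left _ (x j) hr')
        convert this using 1
        ring
      have hpow : ∀ (e : ℕ) (w : A), x i ^ e * w ∈ pw x (T.erase i) b →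
          w ∈ pw x (T.erase i) b := by
        intro e
        induction e with
        | zero => intro w hw; simpa using hw
        | succ e ihe =>
          intro w hw
          apply ihe
          apply ihk _ (T.erase i) b hcard le_rfl i (Finset.notMem_erase i T)
          convert hw using 1
          ring
      have h3 := hpow _ _ h2
      have h4 : r' ∈ pw x T (Function.update b i 0) := by
        apply ihn T _ hT (hsum _ (by omega)) j hj
        rw [mem_pw_iff _ _ _ i hi, her]
        refine ⟨q, ?_⟩
        rw [Function.update_self]
        convert h3 using 1
        ring
      obtain ⟨p, hp⟩ := (mem_pw_iff x T _ i hi _).1 h4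
      rw [her, Function.update_self] at hp
      rw [mem_pw_iff _ _ _ i hi]
      refine ⟨p, ?_⟩
      have e : b i - 1 + 1 = b i := by omega
      rw [e] at hr'
      have := Ideal.add_mem _ hr' (Ideal.mul_mem_left _ (x i ^ b i) hp)
      convert this using 1
      ring

lemma GoodSeq.pow_nzd {A : Type*} [CommRing A] {ι : Type*} {x : ι → A} (hx : GoodSeq x)
    (T : Finset ι) (b : ι → ℕ) (i : ι) (hi : i ∉ T) :
    ∀ (e : ℕ) (w : A), x i ^ e * w ∈ pw x T b → w ∈ pw x T b := by
  intro e
  induction e with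
  | zero => intro w hw; simpa using hw
  | succ e ihe =>
    intro w hw
    apply ihe
    apply hx.nzd _ _ T b le_rfl le_rfl i hi
    convert hw using 1
    ring

lemma GoodSeq.mono_aux {A : Type*} [CommRing A] {ι : Type*} {x : ι → A} (hx : GoodSeq x)
    (W : Finset ι) (c : A) (T : Finset ι) :
    ∀ (b : ι → ℕ), T ⊆ W → (∀ i ∈ W, i ∉ T → b i = 0) → c * ∏ i ∈ T, x i ^ b i ∈ pw x W b →
      c ∈ Ideal.span (x '' (W : Set ι)) := by
  classical
  induction T using Finset.induction_on with
  | empty =>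
    intro b _ h0 hc
    rw [pw_congr x W b (fun _ => 0) (fun i hi => h0 i hi (by simp))] at hc
    simpa [pw] using hc
  | insert i T hiT ih =>
    intro b hTW h0 hc
    have hiW : i ∈ W := hTW (Finset.mem_insert_self _ _)
    have her : ∀ c, pw x (W.erase i) (Function.update b i c) = pw x (W.erase i) b := by
      intro c
      apply pw_congr
      intro l hl
      rw [Function.update_of_ne (Finset.ne_of_mem_erase hl)]
    apply ih (Function.update b i 0) ((Finset.subset_insert _ _).trans hTW)
    · intro l hl hlT
      by_cases hli : l = i
      · subst hli; simp
      · rw [Function.update_of_ne hli]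
        exact h0 l hl (by simp [hli, hlT])
    · have hprod : ∏ l ∈ T, x l ^ (Function.update b i 0 l) = ∏ l ∈ T, x l ^ b l := by
        apply Finset.prod_congr rfl
        intro l hl
        rw [Function.update_of_ne (by rintro rfl; exact hiT hl)]
      rw [hprod, mem_pw_iff _ _ _ i hiW, her]
      obtain ⟨q, hq⟩ := (mem_pw_iff x W b i hiW _).1 hc
      refine ⟨q, ?_⟩
      apply hx.pow_nzd _ b i (Finset.notMem_erase i W) (b i)
      rw [Finset.prod_insert hiT] at hq
      convert hq using 1
      rw [Function.update_self]; ring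

lemma GoodSeq.mono {A : Type*} [CommRing A] {ι : Type*} [Fintype ι] {x : ι → A} (hx : GoodSeq x)
    (b : ι → ℕ) (c : A)
    (h : c * ∏ i, x i ^ b i ∈ Ideal.span (Set.range (fun i => x i ^ (b i + 1)))) :
    c ∈ Ideal.span (Set.range x) := by
  have := hx.mono_aux Finset.univ c Finset.univ b (Finset.Subset.refl _) (by simp)
    (by simpa [pw] using h)
  simpa using this

/-! ### Part 2: regular local rings are domains, parameters form good sequences -/

lemma isLocalRing_quot {A : Type*} [CommRing A] [IsLocalRing A] (I : Ideal A)
    (hI : I ≤ maximalIdeal A) : IsLocalRing (A ⧸ I) := by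
  have : Nontrivial (A ⧸ I) := Ideal.Quotient.nontrivial_iff.2
    (fun h => (maximalIdeal.isMaximal A).ne_top (top_le_iff.1 (h ▸ hI)))
  exact IsLocalRing.of_surjective' (Ideal.Quotient.mk I) Ideal.Quotient.mk_surjective

lemma maximalIdeal_quot {A : Type*} [CommRing A] [IsLocalRing A] (I : Ideal A)
    (hI : I ≤ maximalIdeal A) [IsLocalRing (A ⧸ I)] :
    (maximalIdeal A).map (Ideal.Quotient.mk I) = maximalIdeal (A ⧸ I) := by
  apply IsLocalRing.eq_maximalIdeal
  rcases Ideal.map_eq_top_or_isMaximal_of_surjective (Ideal.Quotient.mk I)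
    Ideal.Quotient.mk_surjective (maximalIdeal.isMaximal A) with h | h
  · exfalso
    have h1 := Ideal.comap_map_of_surjective (Ideal.Quotient.mk I)
      Ideal.Quotient.mk_surjective (maximalIdeal A)
    rw [h, Ideal.comap_top, ← RingHom.ker_eq_comap_bot, Ideal.mk_ker, sup_eq_left.2 hI] at h1
    exact (maximalIdeal.isMaximal A).ne_top h1.symm
  · exact h

lemma dim_quot {A : Type*} [CommRing A] [IsLocalRing A] [IsNoetherianRing A]
    (s : Finset A) (hs : (s : Set A) ⊆ maximalIdeal A) (k n : ℕ) (hk : s.card + k ≤ n)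
    (hd : (n : WithBot ℕ∞) ≤ ringKrullDim A) :
    (k : WithBot ℕ∞) ≤ ringKrullDim (A ⧸ Ideal.span (s : Set A)) := by
  have h := ringKrullDim_le_ringKrullDim_quotient_add_card s
    (by rw [IsLocalRing.ringJacobson_eq_maximalIdeal]; exact hs)
  have h2 := hd.trans h
  have hnt : Nontrivial (A ⧸ Ideal.span (s : Set A)) := Ideal.Quotient.nontrivial_iff.2
    (fun h => (maximalIdeal.isMaximal A).ne_top (top_le_iff.1 (h ▸ Ideal.span_le.2 hs)))
  have h3 : ((k + s.card : ℕ) : WithBot ℕ∞) ≤ ringKrullDim (A ⧸ Ideal.span (s : Set A)) + s.card :=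
    le_trans (by exact_mod_cast (by omega : k + s.card ≤ n)) h2
  generalize ringKrullDim (A ⧸ Ideal.span (s : Set A)) = D at h3
  induction D with
  | bot => simp at h3
  | coe D =>
    have h4 : ((k + s.card : ℕ) : ℕ∞) ≤ D + s.card := by exact_mod_cast h3
    have h5 : (k : ℕ∞) ≤ D := by
      push_cast at h4
      exact (ENat.add_le_add_iff_right (by simp)).1 h4
    exact_mod_cast h5

lemma dom_fin : ∀ (n : ℕ) (A : Type u) [CommRing A] [IsLocalRing A] [IsNoetherianRing A]
    (x : Fin n → A), Ideal.span (Set.range x) = maximalIdeal A →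
    (n : WithBot ℕ∞) ≤ ringKrullDim A → IsDomain A := by
  intro n
  induction n with
  | zero =>
    intro A _ _ _ x hx _
    have h0 : maximalIdeal A = ⊥ := by rw [← hx]; simp
    have : (⊥ : Ideal A).IsPrime := h0 ▸ (maximalIdeal.isMaximal A).isPrime
    exact IsDomain.of_bot_isPrime A
  | succ n ih =>
    intro A _ _ _ x hx hd
    have hnm : maximalIdeal A ∉ minimalPrimes A := by
      intro h
      have h1 := Ideal.height_eq_zero_iff.2 h
      have h2 := IsLocalRing.maximalIdeal_height_eq_ringKrullDim (R := A)
      rw [h1] at h2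
      rw [← h2] at hd
      have : n + 1 ≤ 0 := by exact_mod_cast hd
      omega
    have hfin := Ideal.finite_minimalPrimes_of_isNoetherianRing A ⊥
    classical
    obtain ⟨w, hwM, hw⟩ : ∃ w ∈ maximalIdeal A, w ∉ (maximalIdeal A) ^ 2 ∧
        ∀ q ∈ minimalPrimes A, w ∉ q := by
      by_contra! hcon
      have hsub : ((maximalIdeal A : Ideal A) : Set A) ⊆
          ⋃ i ∈ ((insert ((maximalIdeal A) ^ 2) hfin.toFinset : Finset (Ideal A)) : Set (Ideal A)),
            ((id i : Ideal A) : Set A) := by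
        intro w hw
        by_cases h2 : w ∈ (maximalIdeal A) ^ 2
        · simp only [Set.mem_iUnion]
          exact ⟨_, by simp, h2⟩
        · obtain ⟨q, hq, hwq⟩ := hcon w hw h2
          simp only [Set.mem_iUnion]
          refine ⟨q, ?_, hwq⟩
          rw [Finset.coe_insert]
          exact Set.mem_insert_of_mem _ (by simpa using hq)
      rw [Ideal.subset_union_prime (f := id) ((maximalIdeal A)^2) ((maximalIdeal A)^2)] at hsub
      · obtain ⟨q, hq, hMq⟩ := hsub
        have key : ∀ q ∈ minimalPrimes A, ¬ maximalIdeal A ≤ q := by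
          intro q hq h
          apply hnm
          have hp : q.IsPrime := hq.1.1
          rwa [le_antisymm h (IsLocalRing.le_maximalIdeal hp.ne_top)]
        rcases Finset.mem_insert.1 hq with h | h
        · subst h
          have hbot := Submodule.eq_bot_of_le_smul_of_le_jacobson_bot (maximalIdeal A)
            (maximalIdeal A) (IsNoetherian.noetherian _)
            (by simpa [sq] using hMq) (by rw [IsLocalRing.jacobson_eq_maximalIdeal _ bot_ne_top])
          obtain ⟨q, hq, -⟩ := Ideal.exists_minimalPrimes_le (bot_le : (⊥ : Ideal A) ≤ maximalIdeal A)
          exact key q hq (hbot ▸ bot_le)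
        · exact key q (by simpa using h) hMq
      · intro q hq h1 _
        rcases Finset.mem_insert.1 hq with h | h
        · exact absurd h h1
        · have : q ∈ minimalPrimes A := by simpa using h
          exact this.1.1
    have hwx : w ∈ Ideal.span (Set.range x) := hx ▸ hwM
    obtain ⟨c, hc⟩ := (Ideal.mem_span_range_iff_exists_fun).1 hwx
    have hxM : ∀ i, x i ∈ maximalIdeal A := fun i => hx ▸ Ideal.subset_span ⟨i, rfl⟩
    obtain ⟨j, hj⟩ : ∃ j, IsUnit (c j) := by
      by_contra! hcon
      apply hw.1
      rw [← hc, sq]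
      apply Ideal.sum_mem
      intro i _
      exact Ideal.mul_mem_mul ((IsLocalRing.mem_maximalIdeal _).2 (hcon i)) (hxM i)
    have hI : Ideal.span (({w} : Finset A) : Set A) ≤ maximalIdeal A := by
      rw [Ideal.span_le]; simpa using hwM
    have := isLocalRing_quot _ hI
    have hdq := dim_quot {w} (by simpa using hwM) n (n+1) (by simp; omega) hd
    have hdom := ih (A ⧸ Ideal.span (({w} : Finset A) : Set A))
      (fun i => Ideal.Quotient.mk _ (x (j.succAbove i))) (by
        rw [← maximalIdeal_quot _ hI, ← hx, Ideal.map_span]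
        apply le_antisymm
        · apply Ideal.span_mono
          rintro _ ⟨i, rfl⟩
          exact ⟨_, ⟨_, rfl⟩, rfl⟩
        · rw [Ideal.span_le]
          rintro _ ⟨_, ⟨i, rfl⟩, rfl⟩
          rcases Fin.eq_self_or_eq_succAbove j i with h | ⟨k, h⟩
          · subst h
            have e1 : (Ideal.Quotient.mk (Ideal.span (({w} : Finset A) : Set A))) w = 0 :=
              Ideal.Quotient.eq_zero_iff_mem.2 (Ideal.subset_span (by simp))
            have e0 := congrArg (Ideal.Quotient.mk (Ideal.span (({w} : Finset A) : Set A))) hc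
            rw [e1, Fin.sum_univ_succAbove _ i, map_add, map_mul, map_sum] at e0
            have hu := hj.map (Ideal.Quotient.mk (Ideal.span (({w} : Finset A) : Set A)))
            have e2 := eq_neg_of_add_eq_zero_left e0
            rw [SetLike.mem_coe, ← Ideal.unit_mul_mem_iff_mem _ hu, e2]
            apply neg_mem
            apply Ideal.sum_mem
            intro k _
            rw [map_mul]
            exact Ideal.mul_mem_left _ _ (Ideal.subset_span ⟨k, rfl⟩)
          · subst h
            exact Ideal.subset_span ⟨k, rfl⟩) hdq
    have hp : (Ideal.span (({w} : Finset A) : Set A)).IsPrime :=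
      (Ideal.Quotient.isDomain_iff_prime _).1 hdom
    obtain ⟨q, hq, hqw⟩ := Ideal.exists_minimalPrimes_le
      (bot_le : (⊥ : Ideal A) ≤ Ideal.span (({w} : Finset A) : Set A))
    have hqp : q.IsPrime := hq.1.1
    have hq0 : q = ⊥ := by
      apply Submodule.eq_bot_of_le_smul_of_le_jacobson_bot (maximalIdeal A) q
        (IsNoetherian.noetherian _) _ (by rw [IsLocalRing.jacobson_eq_maximalIdeal _ bot_ne_top])
      intro a ha
      have := hqw ha
      rw [Finset.coe_singleton, Ideal.mem_span_singleton] at this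
      obtain ⟨b, rfl⟩ := this
      have hb := (hqp.mem_or_mem ha).resolve_left (hw.2 q hq)
      exact Submodule.smul_mem_smul hwM hb
    have : (⊥ : Ideal A).IsPrime := hq0 ▸ hqp
    exact IsDomain.of_bot_isPrime A

lemma dom_fintype {ι : Type*} [Fintype ι] (A : Type u) [CommRing A] [IsLocalRing A]
    [IsNoetherianRing A]
    (x : ι → A) (hx : Ideal.span (Set.range x) = maximalIdeal A)
    (hd : (Fintype.card ι : WithBot ℕ∞) ≤ ringKrullDim A) : IsDomain A := by
  refine dom_fin (Fintype.card ι) A (x ∘ (Fintype.equivFin ι).symm) ?_ hd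
  rw [(Fintype.equivFin ι).symm.surjective.range_comp, hx]

lemma goodSeq_of_rsp {n : ℕ} (A : Type u) [CommRing A] [IsLocalRing A] [IsNoetherianRing A]
    (x : Fin n → A) (hx : Ideal.span (Set.range x) = maximalIdeal A)
    (hd : (n : WithBot ℕ∞) ≤ ringKrullDim A) : GoodSeq x := by
  classical
  have hxM : ∀ i, x i ∈ maximalIdeal A := fun i => hx ▸ Ideal.subset_span ⟨i, rfl⟩
  intro T j hj r hr
  have hI : Ideal.span (x '' (T : Set (Fin n))) ≤ maximalIdeal A := by
    rw [Ideal.span_le]; rintro _ ⟨i, _, rfl⟩; exact hxM i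
  have hI' : Ideal.span (x '' (T : Set (Fin n))) = Ideal.span ((T.image x : Finset A) : Set A) := by
    simp
  have hp : (Ideal.span (x '' (T : Set (Fin n)))).IsPrime := by
    rw [hI'] at hI ⊢
    have := isLocalRing_quot _ hI
    have hdq := dim_quot (T.image x) (by
      intro a ha
      simp only [Finset.coe_image] at ha
      obtain ⟨i, _, rfl⟩ := ha
      exact hxM i) (n - T.card) n (by
        have h1 := Finset.card_image_le (s := T) (f := x)
        have h2 := Finset.card_le_univ T
        rw [Fintype.card_fin] at h2
        omega) hd
    rw [← Ideal.Quotient.isDomain_iff_prime]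
    refine dom_fintype (ι := {i // i ∉ T}) _ (fun i => Ideal.Quotient.mk _ (x i)) ?_ ?_
    · rw [← maximalIdeal_quot _ hI, ← hx, Ideal.map_span]
      apply le_antisymm
      · apply Ideal.span_mono
        rintro _ ⟨i, rfl⟩
        exact ⟨_, ⟨_, rfl⟩, rfl⟩
      · rw [Ideal.span_le]
        rintro _ ⟨_, ⟨i, rfl⟩, rfl⟩
        by_cases hi : i ∈ T
        · have : Ideal.Quotient.mk (Ideal.span ((T.image x : Finset A) : Set A)) (x i) = 0 :=
            Ideal.Quotient.eq_zero_iff_mem.2 (Ideal.subset_span (by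
              simpa using ⟨i, hi, rfl⟩))
          rw [this]
          exact Ideal.zero_mem _
        · exact Ideal.subset_span ⟨⟨i, hi⟩, rfl⟩
    · have : Fintype.card {i // i ∉ T} = n - T.card := by
        rw [Fintype.card_subtype_compl]; simp
      rw [this]; exact hdq
  refine (hp.mem_or_mem hr).resolve_left ?_
  intro hjT
  have hM : maximalIdeal A = Ideal.span (((Finset.univ.erase j).image x : Finset A) : Set A) := by
    apply le_antisymm
    · rw [← hx, Ideal.span_le]
      rintro _ ⟨i, rfl⟩
      by_cases hij : i = j
      · subst hij
        apply Ideal.span_mono _ hjT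
        rintro _ ⟨k, hk, rfl⟩
        simp only [Finset.coe_image]
        exact ⟨k, by simp; rintro rfl; exact hj hk, rfl⟩
      · apply Ideal.subset_span
        simp only [Finset.coe_image]
        exact ⟨i, by simpa using hij, rfl⟩
    · rw [Ideal.span_le]
      intro a ha
      simp only [Finset.coe_image] at ha
      obtain ⟨i, _, rfl⟩ := ha
      exact hxM i
  have hmin : maximalIdeal A ∈ (Ideal.span (((Finset.univ.erase j).image x : Finset A) : Set A)).minimalPrimes := by
    rw [← hM, Ideal.minimalPrimes_eq_subsingleton_self]
    rfl
  have h1 := Ideal.height_le_card_of_mem_minimalPrimes_span_finset hmin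
  have h2 := IsLocalRing.maximalIdeal_height_eq_ringKrullDim (R := A)
  rw [← h2] at hd
  have h3 : (n : ℕ∞) ≤ (maximalIdeal A).height := by exact_mod_cast hd
  have h4 := h3.trans h1
  have h5 : n ≤ ((Finset.univ.erase j).image x).card := by exact_mod_cast h4
  have h6 := Finset.card_image_le (s := Finset.univ.erase j) (f := x)
  rw [Finset.card_erase_of_mem (Finset.mem_univ _), Finset.card_univ, Fintype.card_fin] at h6
  have := j.pos
  omega

/-! ### Part 3: monomials in the completion -/

lemma monomial_add {A : Type*} [CommRing A] {d : ℕ} (z : A) (u : Fin d → A)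
    (s t : (Fin d → ℕ) × ℕ) : monomial z u (s + t) = monomial z u s * monomial z u t := by
  simp only [monomial, Prod.snd_add, Prod.fst_add, Pi.add_apply, pow_add, Finset.prod_mul_distrib]
  ring

lemma monomial_dvd {A : Type*} [CommRing A] {d : ℕ} (z : A) (u : Fin d → A)
    {s t : (Fin d → ℕ) × ℕ} (h : s ≤ t) : monomial z u s ∣ monomial z u t := by
  refine ⟨monomial z u (t - s), ?_⟩
  rw [← monomial_add, add_tsub_cancel_of_le h]

/-- unit multiples of monomials lie in monomial ideals only for trivial reasons -/
def MonP {A : Type*} [CommRing A] {d : ℕ} (z : A) (u : Fin d → A) : Prop :=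
  ∀ (E : Set ((Fin d → ℕ) × ℕ)) (s : (Fin d → ℕ) × ℕ) (c : A), IsUnit c →
    c * monomial z u s ∈ Ideal.span (monomial z u '' E) → ∃ e ∈ E, e ≤ s

def Qid {A : Type*} [CommRing A] {d : ℕ} (z : A) (u : Fin d → A) (s : (Fin d → ℕ) × ℕ) : Ideal A :=
  Ideal.span (insert (z ^ (s.2 + 1)) (Set.range fun i => u i ^ (s.1 i + 1)))

lemma monP_of_Qid {A : Type*} [CommRing A] {d : ℕ} (z : A) (u : Fin d → A)
    (h : ∀ s c, IsUnit c → c * monomial z u s ∉ Qid z u s) : MonP z u := by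
  intro E s c hc hmem
  by_contra! hcon
  apply h s c hc
  refine Ideal.span_le.2 ?_ hmem
  rintro _ ⟨e, he, rfl⟩
  have := hcon e he
  rw [Prod.le_def, not_and_or] at this
  rcases this with h1 | h1
  · rw [Pi.le_def] at h1
    push Not at h1
    obtain ⟨i, hi⟩ := h1
    have hd : u i ^ (s.1 i + 1) ∣ monomial z u e := by
      unfold monomial
      apply Dvd.dvd.mul_left
      exact (pow_dvd_pow _ hi).trans (Finset.dvd_prod_of_mem (fun i => u i ^ e.1 i) (Finset.mem_univ i))
    exact Ideal.mem_of_dvd _ hd (Ideal.subset_span (Set.mem_insert_of_mem _ ⟨i, rfl⟩))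
  · have hd : z ^ (s.2 + 1) ∣ monomial z u e := by
      unfold monomial
      apply Dvd.dvd.mul_right
      exact pow_dvd_pow _ (by omega)
    exact Ideal.mem_of_dvd _ hd (Ideal.subset_span (Set.mem_insert _ _))

lemma Qid_base {A : Type u} [CommRing A] [IsLocalRing A] [IsNoetherianRing A] {d : ℕ}
    (z : A) (u : Fin d → A) (hd : ringKrullDim A = (d + 1 : ℕ))
    (hz : Ideal.span (insert z (Set.range u)) = maximalIdeal A) (s : (Fin d → ℕ) × ℕ) (c : A)
    (hc : IsUnit c) : c * monomial z u s ∉ Qid z u s := by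
  intro h
  have hg : GoodSeq (Fin.cons z u : Fin (d+1) → A) :=
    goodSeq_of_rsp A _ (by rw [Fin.range_cons]; exact hz) hd.ge
  have := hg.mono (Fin.cons s.2 s.1) c (by
    rw [Fin.prod_univ_succ]
    have e : (Set.range fun i : Fin (d+1) => (Fin.cons z u : Fin (d+1) → A) i ^
      ((Fin.cons s.2 s.1 : Fin (d+1) → ℕ) i + 1)) =
      insert (z ^ (s.2 + 1)) (Set.range fun i => u i ^ (s.1 i + 1)) := by
      rw [← Fin.range_cons]
      congr 1
      funext i
      refine Fin.cases ?_ (fun i => ?_) i <;> simp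
    rw [e]
    simpa [monomial, Qid] using h)
  rw [Fin.range_cons, hz] at this
  exact (IsLocalRing.mem_maximalIdeal _).1 this hc

lemma Qid_map {A B : Type*} [CommRing A] [CommRing B] (φ : A →+* B) {d : ℕ} (z : A) (u : Fin d → A)
    (s : (Fin d → ℕ) × ℕ) : (Qid z u s).map φ = Qid (φ z) (fun i => φ (u i)) s := by
  unfold Qid
  rw [Ideal.map_span, Set.image_insert_eq, ← Set.range_comp]
  simp [Function.comp_def]

lemma monomial_map {A B : Type*} [CommRing A] [CommRing B] (φ : A →+* B) {d : ℕ} (z : A)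
    (u : Fin d → A)
    (s : (Fin d → ℕ) × ℕ) : φ (monomial z u s) = monomial (φ z) (fun i => φ (u i)) s := by
  simp [monomial]

lemma monP_completion {A : Type u} [CommRing A] [IsLocalRing A] [IsNoetherianRing A] {d : ℕ}
    (u : Fin d → A) (hd : ringKrullDim A = (d + 1 : ℕ)) (z : Completion A)
    (hz : IsRSPhat A z u) : MonP z (fun i => cmpl (u i)) := by
  apply monP_of_Qid
  intro s c hc hmem
  set uh : Fin d → Completion A := fun i => cmpl (u i) with huh
  set Mh : Ideal (Completion A) := (maximalIdeal A).map (cmpl (R := A)) with hMh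
  have hz' : Ideal.span (insert z (Set.range uh)) = Mh := hz
  have hrad : Mh ≤ (Qid z uh s).radical := by
    rw [← hz', Ideal.span_le]
    rintro w (rfl | ⟨i, rfl⟩)
    · exact ⟨_, Ideal.subset_span (Set.mem_insert _ _)⟩
    · exact ⟨_, Ideal.subset_span (Set.mem_insert_of_mem _ ⟨i, rfl⟩)⟩
  have hfg : Mh.FG := Ideal.FG.map (IsNoetherian.noetherian _) _
  obtain ⟨n, hn⟩ := Ideal.exists_pow_le_of_le_radical_of_fg hrad hfg
  set N := n + 2 with hN
  let π : Completion A →+* A ⧸ (maximalIdeal A) ^ N :=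
    (AdicCompletion.evalₐ (maximalIdeal A) N).toRingHom
  have hπ : ∀ a : A, π (cmpl a) = Ideal.Quotient.mk _ a := by
    intro a
    exact (AdicCompletion.evalₐ (maximalIdeal A) N).commutes a
  have hπc : π.comp cmpl = Ideal.Quotient.mk ((maximalIdeal A) ^ N) := RingHom.ext hπ
  obtain ⟨z0, hz0⟩ := Ideal.Quotient.mk_surjective (π z)
  obtain ⟨c0, hc0⟩ := Ideal.Quotient.mk_surjective (π c)
  have hNM : (maximalIdeal A) ^ N ≤ maximalIdeal A := Ideal.pow_le_self (by omega)
  have hjac : maximalIdeal A ≤ Ideal.jacobson ⊥ := by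
    rw [IsLocalRing.jacobson_eq_maximalIdeal _ bot_ne_top]
  have hgenmap : Ideal.map π Mh = Ideal.map (Ideal.Quotient.mk ((maximalIdeal A) ^ N))
      (Ideal.span (insert z0 (Set.range u))) := by
    rw [← hz', Ideal.map_span, Ideal.map_span, Set.image_insert_eq, Set.image_insert_eq, hz0,
      ← Set.range_comp, ← Set.range_comp]
    congr 3
  have hgen2 : Ideal.map π Mh = Ideal.map (Ideal.Quotient.mk ((maximalIdeal A) ^ N)) (maximalIdeal A) := by
    rw [hMh, Ideal.map_map, hπc]
  have hQmap : Ideal.map π (Qid z uh s) = Ideal.map (Ideal.Quotient.mk ((maximalIdeal A) ^ N))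
      (Qid z0 u s) := by
    rw [Qid_map, Qid_map, hz0]
    congr 1
  have lift : ∀ (I J : Ideal A), Ideal.map (Ideal.Quotient.mk ((maximalIdeal A) ^ N)) I ≤
      Ideal.map (Ideal.Quotient.mk ((maximalIdeal A) ^ N)) J → I ≤ J ⊔ (maximalIdeal A) ^ N := by
    intro I J h a ha
    exact Ideal.mem_quotient_iff_mem_sup.1 (h (Ideal.mem_map_of_mem _ ha))
  have hsp : Ideal.span (insert z0 (Set.range u)) = maximalIdeal A := by
    apply le_antisymm
    · refine (lift _ _ (hgenmap.symm.trans hgen2).le).trans (sup_le le_rfl hNM)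
    · have h1 := lift _ _ (hgen2.symm.trans hgenmap).le
      apply Submodule.le_of_le_smul_of_le_jacobson_bot (IsNoetherian.noetherian _) hjac
      refine h1.trans (sup_le_sup le_rfl ?_)
      rw [smul_eq_mul, ← sq]
      exact Ideal.pow_le_pow_right (by omega)
  have hQn : (maximalIdeal A) ^ n ≤ Qid z0 u s := by
    apply Submodule.le_of_le_smul_of_le_jacobson_bot (IsNoetherian.noetherian _) hjac
    refine (lift _ _ ?_).trans (sup_le_sup (le_refl (Qid z0 u s)) ?_)
    · rw [← hQmap, ← hπc, ← Ideal.map_map]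
      apply Ideal.map_mono
      rw [Ideal.map_pow]
      exact hn
    · rw [smul_eq_mul, ← pow_succ']
      exact Ideal.pow_le_pow_right (by omega)
  have hfin : c0 * monomial z0 u s ∈ Qid z0 u s := by
    have h1 : π (c * monomial z uh s) ∈ Ideal.map π (Qid z uh s) := Ideal.mem_map_of_mem _ hmem
    rw [hQmap, map_mul, monomial_map, ← hc0, ← hz0] at h1
    have h2 : (fun i => π (uh i)) = fun i => Ideal.Quotient.mk ((maximalIdeal A) ^ N) (u i) := by
      funext i; exact hπ _
    rw [h2, ← monomial_map, ← map_mul] at h1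
    have h3 := Ideal.mem_quotient_iff_mem_sup.1 h1
    exact sup_le le_rfl ((Ideal.pow_le_pow_right (by omega)).trans hQn) h3
  refine Qid_base z0 u hd hsp s c0 ?_ hfin
  have : IsUnit (Ideal.Quotient.mk ((maximalIdeal A) ^ N) c0) := by
    rw [hc0]; exact hc.map π
  obtain ⟨b, hb⟩ := this.exists_right_inv
  obtain ⟨b0, rfl⟩ := Ideal.Quotient.mk_surjective b
  rw [← map_mul, ← map_one (Ideal.Quotient.mk _), Ideal.Quotient.eq] at hb
  by_contra hcu
  have h1 : c0 ∈ maximalIdeal A := (IsLocalRing.mem_maximalIdeal _).2 hcu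
  have h2 : (1 : A) ∈ maximalIdeal A := by
    have := Ideal.sub_mem _ (Ideal.mul_mem_right b0 _ h1) (hNM hb)
    simp at this
  exact (maximalIdeal.isMaximal A).ne_top ((Ideal.eq_top_iff_one _).2 h2)

lemma ordRes_spec {A : Type u} [CommRing A] [IsLocalRing A] [IsNoetherianRing A] {d : ℕ}
    (u : Fin d → A) (huM : Ideal.span (Set.range u) ≤ maximalIdeal A) (f : A)
    (hf : f ∈ maximalIdeal A) (hfu : f ∉ Ideal.span (Set.range u)) :
    1 ≤ ordRes f u ∧ f ∈ (maximalIdeal A) ^ (ordRes f u) ⊔ Ideal.span (Set.range u) ∧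
      f ∉ (maximalIdeal A) ^ (ordRes f u + 1) ⊔ Ideal.span (Set.range u) := by
  set U := Ideal.span (Set.range u) with hU
  set S := {n : ℕ | f ∈ (maximalIdeal A) ^ n ⊔ U} with hS
  have h1 : 1 ∈ S := by
    show f ∈ (maximalIdeal A) ^ 1 ⊔ U
    rw [pow_one]; exact Ideal.mem_sup_left hf
  have hbdd : BddAbove S := by
    by_contra hb
    rw [not_bddAbove_iff] at hb
    apply hfu
    have hall : ∀ n, f ∈ (maximalIdeal A) ^ n ⊔ U := by
      intro n
      obtain ⟨k, hk, hnk⟩ := hb n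
      have hle : (maximalIdeal A) ^ k ⊔ U ≤ (maximalIdeal A) ^ n ⊔ U :=
        sup_le_sup (Ideal.pow_le_pow_right hnk.le) le_rfl
      exact hle hk
    have := Ideal.iInf_pow_smul_eq_bot_of_isLocalRing (M := A ⧸ U) (maximalIdeal A)
      (maximalIdeal.isMaximal A).ne_top
    have h2 : (Ideal.Quotient.mk U f) ∈ (⨅ i : ℕ, maximalIdeal A ^ i • ⊤ : Submodule A (A ⧸ U)) := by
      rw [Submodule.mem_iInf]
      intro n
      obtain ⟨a, ha, b, hb, hab⟩ := Submodule.mem_sup.1 (hall n)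
      have e : Ideal.Quotient.mk U f = a • (1 : A ⧸ U) := by
        rw [← hab, map_add, Ideal.Quotient.eq_zero_iff_mem.2 hb, add_zero, Algebra.smul_def, mul_one]
        rfl
      rw [e]
      exact Submodule.smul_mem_smul ha trivial
    rw [this] at h2
    exact Ideal.Quotient.eq_zero_iff_mem.1 ((Submodule.mem_bot _).1 h2)
  have hmem : ordRes f u ∈ S := Nat.sSup_mem ⟨1, h1⟩ hbdd
  refine ⟨le_csSup hbdd h1, hmem, fun h => ?_⟩
  have := le_csSup hbdd (show ordRes f u + 1 ∈ S from h)
  change ordRes f u + 1 ≤ ordRes f u at this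
  omega

lemma maxIdeal_hat {A : Type u} [CommRing A] [IsLocalRing A] [IsNoetherianRing A] :
    maximalIdeal (Completion A) = (maximalIdeal A).map (cmpl (R := A)) :=
  AdicCompletion.maximalIdeal_eq_map

lemma ord_hat {A : Type u} [CommRing A] [IsLocalRing A] [IsNoetherianRing A] {d : ℕ}
    (u : Fin d → A) (f : A) (n : ℕ) :
    cmpl f ∈ (maximalIdeal (Completion A)) ^ n ⊔ Ideal.span (Set.range fun i => cmpl (u i)) ↔
      f ∈ (maximalIdeal A) ^ n ⊔ Ideal.span (Set.range u) := by
  have e : (maximalIdeal (Completion A)) ^ n ⊔ Ideal.span (Set.range fun i => cmpl (u i)) =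
      ((maximalIdeal A) ^ n ⊔ Ideal.span (Set.range u)).map (cmpl (R := A)) := by
    rw [maxIdeal_hat, Ideal.map_sup, Ideal.map_pow, Ideal.map_span, ← Set.range_comp]
    rfl
  rw [e]
  refine ⟨fun h => ?_, fun h => Ideal.mem_map_of_mem _ h⟩
  let π : Completion A →+* A ⧸ (maximalIdeal A) ^ n :=
    (AdicCompletion.evalₐ (maximalIdeal A) n).toRingHom
  have hπ : ∀ a : A, π (cmpl a) = Ideal.Quotient.mk _ a := by
    intro a
    exact (AdicCompletion.evalₐ (maximalIdeal A) n).commutes a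
  have hπc : π.comp cmpl = Ideal.Quotient.mk ((maximalIdeal A) ^ n) := RingHom.ext hπ
  have h1 := Ideal.mem_map_of_mem π h
  rw [Ideal.map_map, hπ, hπc] at h1
  have h3 := Ideal.mem_quotient_iff_mem_sup.1 h1
  rwa [sup_eq_left.2 le_sup_left] at h3

lemma hat_complete {A : Type u} [CommRing A] [IsLocalRing A] [IsNoetherianRing A] :
    IsAdicComplete (maximalIdeal (Completion A)) (Completion A) := inferInstance

/-! ### Part 4: monomial ideals -/

abbrev Ex (d : ℕ) := (Fin d → ℕ) × ℕ

def mI {A : Type*} [CommRing A] {d : ℕ} (z : A) (u : Fin d → A) (E : Set (Ex d)) : Ideal A :=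
  Ideal.span (monomial z u '' E)

lemma mI_mono {A : Type*} [CommRing A] {d : ℕ} (z : A) (u : Fin d → A) {E F : Set (Ex d)}
    (h : E ⊆ F) : mI z u E ≤ mI z u F := Ideal.span_mono (Set.image_mono h)

lemma mem_mI {A : Type*} [CommRing A] {d : ℕ} (z : A) (u : Fin d → A) {E : Set (Ex d)}
    {s : Ex d} (h : s ∈ E) : monomial z u s ∈ mI z u E := Ideal.subset_span ⟨s, h, rfl⟩

lemma mI_union {A : Type*} [CommRing A] {d : ℕ} (z : A) (u : Fin d → A) (E F : Set (Ex d)) :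
    mI z u (E ∪ F) = mI z u E ⊔ mI z u F := by
  unfold mI
  rw [Set.image_union, Ideal.span_union]

def dg {d : ℕ} (s : Ex d) : ℕ := s.2 + ∑ i, s.1 i

lemma dg_mono {d : ℕ} {s t : Ex d} (h : s ≤ t) : dg s ≤ dg t := by
  unfold dg
  have h1 := h.2
  have h2 : ∑ i, s.1 i ≤ ∑ i, t.1 i := Finset.sum_le_sum fun i _ => h.1 i
  omega

lemma dg_add {d : ℕ} (s t : Ex d) : dg (s + t) = dg s + dg t := by
  simp only [dg, Prod.snd_add, Prod.fst_add, Pi.add_apply, Finset.sum_add_distrib]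
  ring

def GG (d n : ℕ) : Set (Ex d) := {s | n ≤ dg s}

lemma GG_upper (d n : ℕ) : IsUpperSet (GG d n) := fun _ _ h hs => le_trans hs (dg_mono h)

lemma GG_compl_finite (d n : ℕ) : (GG d n)ᶜ.Finite := by
  have hfin : (Set.univ.pi (fun _ : Fin d => Set.Iic n) ×ˢ Set.Iic n).Finite :=
    Set.Finite.prod (Set.Finite.pi fun _ => Set.finite_Iic n) (Set.finite_Iic n)
  apply hfin.subset
  intro s hs
  simp only [GG, Set.mem_compl_iff, Set.mem_ofPred_eq, not_le] at hs
  refine ⟨fun i _ => ?_, ?_⟩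
  · have h1 : s.1 i ≤ ∑ i, s.1 i := Finset.single_le_sum (f := s.1) (fun _ _ => Nat.zero_le _) (Finset.mem_univ i)
    simp only [dg] at hs
    show s.1 i ≤ n
    omega
  · simp only [dg] at hs
    show s.2 ≤ n
    omega

lemma dickson {d : ℕ} (E : Set (Ex d)) : ∃ T : Finset (Ex d), (T : Set (Ex d)) ⊆ E ∧
    (∀ e ∈ E, ∃ s ∈ T, s ≤ e) ∧ (∀ s ∈ T, ∀ e ∈ E, e ≤ s → e = s) := by
  have hfin : {s | Minimal (· ∈ E) s}.Finite :=
    WellQuasiOrderedLE.finite_of_isAntichain (setOfPred_minimal_antichain _)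
  refine ⟨hfin.toFinset, ?_, ?_, ?_⟩
  · intro s hs
    have : Minimal (· ∈ E) s := by simpa using hs
    exact this.1
  · intro e he
    obtain ⟨b, hb, hm⟩ := exists_minimal_le_of_wellFoundedLT (· ∈ E) e he
    exact ⟨b, by simpa using hm, hb⟩
  · intro s hs e he hes
    have : Minimal (· ∈ E) s := by simpa using hs
    exact le_antisymm hes (this.2 he hes)

lemma mI_upper {A : Type*} [CommRing A] {d : ℕ} (z : A) (u : Fin d → A) (T : Set (Ex d))
    (E : Set (Ex d)) (h : ∀ e ∈ E, ∃ s ∈ T, s ≤ e) : mI z u E ≤ mI z u T := by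
  unfold mI
  rw [Ideal.span_le]
  rintro _ ⟨e, he, rfl⟩
  obtain ⟨s, hs, hse⟩ := h e he
  exact Ideal.mem_of_dvd _ (monomial_dvd z u hse) (mem_mI z u hs)

lemma monomial_zsucc {A : Type*} [CommRing A] {d : ℕ} (z : A) (u : Fin d → A) (s : Ex d) :
    z * monomial z u s = monomial z u (s + (0, 1)) := by
  rw [monomial_add]
  simp [monomial]; ring

lemma monomial_usucc {A : Type*} [CommRing A] {d : ℕ} (z : A) (u : Fin d → A) (s : Ex d) (i : Fin d) :
    u i * monomial z u s = monomial z u (s + (Pi.single i 1, 0)) := by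
  rw [monomial_add]
  have : ∏ j, u j ^ (Pi.single i 1 : Fin d → ℕ) j = u i := by
    rw [Finset.prod_eq_single i]
    · simp
    · intro j _ hj; simp [Pi.single_eq_of_ne hj]
    · simp
  simp [monomial, this]; ring

lemma dg_single {d : ℕ} (i : Fin d) : dg ((Pi.single i 1, 0) : Ex d) = 1 := by
  simp [dg, Finset.sum_pi_single']

section
variable {A : Type*} [CommRing A] [IsLocalRing A] {d : ℕ} {z : A} {u : Fin d → A}

lemma mul_mono_mem (hz : Ideal.span (insert z (Set.range u)) = maximalIdeal A) (s : Ex d)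
    (c : A) (hc : c ∈ maximalIdeal A) : c * monomial z u s ∈ mI z u {t | s ≤ t ∧ dg s + 1 ≤ dg t} := by
  rw [← hz] at hc
  refine Submodule.span_induction (p := fun c _ => c * monomial z u s ∈ _) ?_ ?_ ?_ ?_ hc
  · rintro w (rfl | ⟨i, rfl⟩)
    · rw [monomial_zsucc]
      apply mem_mI
      refine ⟨le_self_add, ?_⟩
      rw [dg_add]; simp [dg]
    · rw [monomial_usucc]
      apply mem_mI
      refine ⟨le_self_add, ?_⟩
      rw [dg_add, dg_single]
  · simp
  · intro a b _ _ ha hb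
    rw [add_mul]; exact Ideal.add_mem _ ha hb
  · intro a b _ hb
    rw [smul_eq_mul, mul_assoc]; exact Ideal.mul_mem_left _ _ hb

lemma monomial_mem_pow (hz : Ideal.span (insert z (Set.range u)) = maximalIdeal A) (s : Ex d) :
    monomial z u s ∈ (maximalIdeal A) ^ (dg s) := by
  have h1 : z ∈ maximalIdeal A := hz ▸ Ideal.subset_span (Set.mem_insert _ _)
  have h2 : ∀ i, u i ∈ maximalIdeal A :=
    fun i => hz ▸ Ideal.subset_span (Set.mem_insert_of_mem _ ⟨i, rfl⟩)
  unfold monomial dg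
  rw [pow_add, ← Finset.prod_pow_eq_pow_sum]
  exact Ideal.mul_mem_mul (Ideal.pow_mem_pow h1 _)
    (Ideal.prod_mem_prod fun i _ => Ideal.pow_mem_pow (h2 i) _)

lemma pow_eq_mI (hz : Ideal.span (insert z (Set.range u)) = maximalIdeal A) (n : ℕ) :
    (maximalIdeal A) ^ n = mI z u (GG d n) := by
  apply le_antisymm
  · induction n with
    | zero =>
      have : (1 : A) ∈ mI z u (GG d 0) := by
        have := mem_mI z u (E := GG d 0) (s := 0) (Nat.zero_le _)
        simpa [monomial] using this
      rw [(Ideal.eq_top_iff_one _).2 this]; exact le_top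
    | succ n ih =>
      rw [pow_succ']
      refine (Ideal.mul_mono_right ih).trans ?_
      unfold mI
      rw [Ideal.mul_le]
      intro c hc w hw
      refine Submodule.span_induction (p := fun w _ => c * w ∈ _) ?_ ?_ ?_ ?_ hw
      · rintro _ ⟨s, hs, rfl⟩
        refine mI_mono z u ?_ (mul_mono_mem hz s c hc)
        rintro t ⟨_, ht⟩
        have : n ≤ dg s := hs
        show n + 1 ≤ dg t
        omega
      · simp
      · intro a b _ _ ha hb
        rw [mul_add]; exact Ideal.add_mem _ ha hb
      · intro a b _ hb
        rw [smul_eq_mul, mul_left_comm]; exact Ideal.mul_mem_left _ _ hb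
  · unfold mI
    rw [Ideal.span_le]
    rintro _ ⟨s, hs, rfl⟩
    exact Ideal.pow_le_pow_right hs (monomial_mem_pow hz s)

lemma mI_insert_mem (E : Set (Ex d)) (s : Ex d) (hs : s ∈ E) (g : A) (hg : g ∈ mI z u E) :
    ∃ c h, h ∈ mI z u (E \ {s}) ∧ g = c * monomial z u s + h := by
  have : E = {s} ∪ (E \ {s}) := by
    rw [Set.union_sdiff_cancel]; simpa using hs
  rw [this, mI_union] at hg
  have e : mI z u {s} = Ideal.span {monomial z u s} := by simp [mI]
  rw [e, Ideal.mem_span_singleton_sup] at hg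
  obtain ⟨a, b, hb, h⟩ := hg
  exact ⟨a, b, hb, h.symm⟩

lemma mI_shrink (hz : Ideal.span (insert z (Set.range u)) = maximalIdeal A)
    (E : Set (Ex d)) (hE : IsUpperSet E) (s : Ex d) (hs : s ∈ E) (c h : A)
    (hc : ¬ IsUnit c) (hh : h ∈ mI z u (E \ {s})) :
    c * monomial z u s + h ∈ mI z u (E \ {s}) := by
  refine Ideal.add_mem _ (mI_mono z u ?_ (mul_mono_mem hz s c ((IsLocalRing.mem_maximalIdeal _).2 hc))) hh
  rintro t ⟨hst, ht⟩
  refine ⟨hE hst hs, ?_⟩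
  rintro rfl
  omega

lemma mI_inter_aux (hz : Ideal.span (insert z (Set.range u)) = maximalIdeal A) (hM : MonP z u)
    (E2 : Set (Ex d)) (h2 : IsUpperSet E2) (g : A) (hg2 : g ∈ mI z u E2) :
    ∀ (k : ℕ) (E1 : Set (Ex d)), IsUpperSet E1 → (E1 \ E2).Finite → (E1 \ E2).ncard ≤ k →
      g ∈ mI z u E1 → g ∈ mI z u (E1 ∩ E2) := by
  intro k
  induction k with
  | zero =>
    intro E1 _ hf hk hg
    have : E1 \ E2 = ∅ := (Set.ncard_eq_zero hf).1 (by omega)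
    rwa [Set.inter_eq_left.2 (Set.sdiff_eq_empty.1 this)]
  | succ k ih =>
    intro E1 h1 hf hk hg
    rcases (E1 \ E2).eq_empty_or_nonempty with he | hne
    · rwa [Set.inter_eq_left.2 (Set.sdiff_eq_empty.1 he)]
    obtain ⟨s, hs⟩ := hf.exists_minimal hne
    have hlow : ∀ r ∈ E1, r ≤ s → r = s := by
      intro r hr hrs
      exact le_antisymm hrs (hs.2 ⟨hr, fun h => hs.1.2 (h2 hrs h)⟩ hrs)
    have hup : IsUpperSet (E1 \ {s}) := by
      intro a b hab ha
      refine ⟨h1 hab ha.1, ?_⟩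
      rintro rfl
      exact ha.2 (hlow a ha.1 hab)
    obtain ⟨c, h, hh, rfl⟩ := mI_insert_mem E1 s hs.1.1 g hg
    have hnc : ¬ IsUnit c := by
      intro hc
      have hmem : c * monomial z u s ∈ mI z u (E2 ∪ (E1 \ {s})) := by
        have e : c * monomial z u s = (c * monomial z u s + h) - h := by ring
        rw [e]
        exact Ideal.sub_mem _ (mI_mono z u Set.subset_union_left hg2)
          (mI_mono z u Set.subset_union_right hh)
      obtain ⟨e, he, hes⟩ := hM _ s c hc hmem
      rcases he with he | he
      · exact hs.1.2 (h2 hes he)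
      · exact (hup hes he).2 rfl
    have hg' := mI_shrink hz E1 h1 s hs.1.1 c h hnc hh
    have hsub : (E1 \ {s}) \ E2 ⊂ E1 \ E2 := by
      rw [Set.ssubset_def]
      refine ⟨fun t ht => ⟨ht.1.1, ht.2⟩, fun hc => ?_⟩
      exact (hc hs.1).1.2 rfl
    have := ih (E1 \ {s}) hup (hf.subset hsub.1) (by
      have := Set.ncard_lt_ncard hsub hf
      omega) hg'
    have hss : (E1 \ {s}) ∩ E2 ⊆ E1 ∩ E2 := fun t ht => ⟨ht.1.1, ht.2⟩
    exact mI_mono z u hss this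

lemma mI_inter (hz : Ideal.span (insert z (Set.range u)) = maximalIdeal A) (hM : MonP z u)
    {E1 E2 : Set (Ex d)} (h1 : IsUpperSet E1) (h2 : IsUpperSet E2) (hf : (E1 \ E2).Finite) {g : A}
    (hg1 : g ∈ mI z u E1) (hg2 : g ∈ mI z u E2) : g ∈ mI z u (E1 ∩ E2) :=
  mI_inter_aux hz hM E2 h2 g hg2 _ E1 h1 hf le_rfl hg1

lemma adic_lim [IsAdicComplete (maximalIdeal A) A] (p : ℕ → A)
    (hp : ∀ n, p (n + 1) - p n ∈ (maximalIdeal A) ^ n) :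
    ∃ L, ∀ n, L - p n ∈ (maximalIdeal A) ^ n := by
  have key : ∀ m k, p (m + k) - p m ∈ (maximalIdeal A) ^ m := by
    intro m k
    induction k with
    | zero => simp
    | succ k ih =>
      have e : p (m + (k + 1)) - p m = (p (m + k + 1) - p (m + k)) + (p (m + k) - p m) := by
        rw [← add_assoc]; ring
      rw [e]
      exact Ideal.add_mem _ (Ideal.pow_le_pow_right (by omega) (hp _)) ih
  obtain ⟨L, hL⟩ := IsPrecomplete.prec' (I := maximalIdeal A) (M := A) p (by
    intro m n hmn
    obtain ⟨k, rfl⟩ := Nat.exists_eq_add_of_le hmn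
    rw [SModEq.comm, SModEq.sub_mem, smul_eq_mul, Ideal.mul_top]
    exact key m k)
  refine ⟨L, fun n => ?_⟩
  have := (hL n).symm
  rwa [SModEq.sub_mem, smul_eq_mul, Ideal.mul_top] at this

lemma adic_haus [IsAdicComplete (maximalIdeal A) A] (x : A)
    (hx : ∀ n, x ∈ (maximalIdeal A) ^ n) : x = 0 := by
  apply IsHausdorff.haus' (I := maximalIdeal A)
  intro n
  rw [SModEq.sub_mem, smul_eq_mul, Ideal.mul_top, sub_zero]
  exact hx n

lemma mI_closed [IsAdicComplete (maximalIdeal A) A]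
    (hz : Ideal.span (insert z (Set.range u)) = maximalIdeal A) (hM : MonP z u)
    {E : Set (Ex d)} (hE : IsUpperSet E) {g : A}
    (hg : ∀ n, g ∈ mI z u (E ∪ GG d n)) : g ∈ mI z u E := by
  obtain ⟨T, hTE, hT, -⟩ := dickson E
  set D := T.sup dg with hD
  have step : ∀ (n : ℕ) (x : A), (x ∈ (maximalIdeal A) ^ n ∧ ∀ k, x ∈ mI z u (E ∪ GG d k)) →
      ∃ c : Ex d → A, (∀ s, c s ∈ (maximalIdeal A) ^ (n - D)) ∧
        (x - ∑ s ∈ T, c s * monomial z u s ∈ (maximalIdeal A) ^ (n + 1) ∧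
        ∀ k, x - ∑ s ∈ T, c s * monomial z u s ∈ mI z u (E ∪ GG d k)) := by
    rintro n x ⟨hx, hxk⟩
    rw [pow_eq_mI hz] at hx
    have h1 := mI_inter hz hM (GG_upper d n) (hE.union (GG_upper d (n+1)))
      ((GG_compl_finite d (n+1)).subset (fun s hs h => hs.2 (Or.inr h))) hx (hxk (n+1))
    have h2 : x ∈ mI z u (GG d n ∩ E) ⊔ mI z u (GG d (n+1)) := by
      rw [← mI_union]
      refine mI_mono z u ?_ h1
      rintro s ⟨hs, h | h⟩
      · exact Or.inl ⟨hs, h⟩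
      · exact Or.inr h
    obtain ⟨a, ha, b, hb, rfl⟩ := Submodule.mem_sup.1 h2
    have h3 : ∀ a ∈ mI z u (GG d n ∩ E), ∃ c : Ex d → A, (∀ s, c s ∈ (maximalIdeal A) ^ (n - D)) ∧
        a = ∑ s ∈ T, c s * monomial z u s := by
      intro a ha
      refine Submodule.span_induction (p := fun a _ => ∃ c : Ex d → A,
        (∀ s, c s ∈ (maximalIdeal A) ^ (n - D)) ∧ a = ∑ s ∈ T, c s * monomial z u s) ?_ ?_ ?_ ?_ ha
      · rintro _ ⟨e, ⟨he1, he2⟩, rfl⟩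
        obtain ⟨s, hs, hse⟩ := hT e he2
        refine ⟨Pi.single s (monomial z u (e - s)), ?_, ?_⟩
        · intro t
          by_cases hts : t = s
          · subst hts
            rw [Pi.single_eq_same]
            refine Ideal.pow_le_pow_right ?_ (monomial_mem_pow hz _)
            have e1 : dg t + dg (e - t) = dg e := by rw [← dg_add, add_tsub_cancel_of_le hse]
            have e2 : dg t ≤ D := Finset.le_sup hs
            have e3 : n ≤ dg e := he1
            omega
          · rw [Pi.single_eq_of_ne hts]; exact Ideal.zero_mem _
        · rw [Finset.sum_eq_single s]
          · rw [Pi.single_eq_same, ← monomial_add, tsub_add_cancel_of_le hse]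
          · intro t _ hts
            rw [Pi.single_eq_of_ne hts, zero_mul]
          · intro h; exact absurd hs h
      · exact ⟨0, by simp, by simp⟩
      · rintro a b _ _ ⟨c, hc, rfl⟩ ⟨c', hc', rfl⟩
        refine ⟨c + c', fun s => Ideal.add_mem _ (hc s) (hc' s), ?_⟩
        simp [add_mul, Finset.sum_add_distrib]
      · rintro r b _ ⟨c, hc, rfl⟩
        refine ⟨r • c, fun s => Ideal.mul_mem_left _ _ (hc s), ?_⟩
        simp [Finset.mul_sum, mul_assoc]
    obtain ⟨c, hc, rfl⟩ := h3 a ha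
    refine ⟨c, hc, ?_, ?_⟩
    · rw [add_sub_cancel_left, pow_eq_mI hz]; exact hb
    · intro k
      refine Ideal.sub_mem _ (hxk k) ?_
      refine mI_mono z u Set.subset_union_left ?_
      exact mI_mono z u Set.inter_subset_right ha
  choose! c hc hx using step
  let x : ℕ → A := fun n => Nat.rec g (fun n x => x - ∑ s ∈ T, c n x s * monomial z u s) n
  have hx0 : x 0 = g := rfl
  have hxs : ∀ n, x (n + 1) = x n - ∑ s ∈ T, c n (x n) s * monomial z u s := fun n => rfl
  have hxn : ∀ n, x n ∈ (maximalIdeal A) ^ n ∧ ∀ k, x n ∈ mI z u (E ∪ GG d k) := by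
    intro n
    induction n with
    | zero => exact ⟨by simp, hg⟩
    | succ n ih => rw [hxs]; exact hx n (x n) ih
  have hlim : ∀ s, ∃ C, ∀ n, C - ∑ k ∈ Finset.range (n + D), c k (x k) s ∈ (maximalIdeal A) ^ n := by
    intro s
    apply adic_lim (fun n => ∑ k ∈ Finset.range (n + D), c k (x k) s)
    intro n
    have : n + 1 + D = (n + D) + 1 := by ring
    simp only [this]
    rw [Finset.sum_range_succ, add_sub_cancel_left]
    have := hc (n + D) (x (n + D)) (hxn _) s
    rwa [Nat.add_sub_cancel] at this
  choose C hC using hlim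
  have hsum : ∀ N, g - ∑ s ∈ T, (∑ k ∈ Finset.range N, c k (x k) s) * monomial z u s = x N := by
    intro N
    induction N with
    | zero => simp [hx0]
    | succ N ih =>
      rw [hxs]
      simp only [Finset.sum_range_succ, add_mul, Finset.sum_add_distrib]
      linear_combination ih
  have hfin : g - ∑ s ∈ T, C s * monomial z u s = 0 := by
    apply adic_haus
    intro n
    have e : g - ∑ s ∈ T, C s * monomial z u s = x (n + D) -
        ∑ s ∈ T, (C s - ∑ k ∈ Finset.range (n + D), c k (x k) s) * monomial z u s := by
      rw [← hsum]
      simp only [sub_mul, Finset.sum_sub_distrib]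
      ring
    rw [e]
    refine Ideal.sub_mem _ (Ideal.pow_le_pow_right (by omega) (hxn _).1) ?_
    apply Ideal.sum_mem
    intro s _
    exact Ideal.mul_mem_right _ _ (hC s n)
  rw [sub_eq_zero] at hfin
  rw [hfin]
  apply Ideal.sum_mem
  intro s hs
  exact Ideal.mul_mem_left _ _ (mem_mI z u (hTE hs))

lemma mem_mI_finset (T : Finset (Ex d)) (g : A) (hg : g ∈ mI z u (T : Set (Ex d))) :
    ∃ c : Ex d → A, g = ∑ s ∈ T, c s * monomial z u s := by
  unfold mI at hg
  obtain ⟨c, hc⟩ := (Submodule.mem_span_image_finset_iff_exists_fun A).1 hg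
  classical
  refine ⟨fun s => if h : s ∈ T then c ⟨s, h⟩ else 0, ?_⟩
  rw [← hc, ← Finset.sum_coe_sort T]
  apply Finset.sum_congr rfl
  rintro ⟨s, hs⟩ _
  simp [hs]

lemma sum_mem_mI (T : Finset (Ex d)) (c : Ex d → A) :
    ∑ s ∈ T, c s * monomial z u s ∈ mI z u (T : Set (Ex d)) :=
  Ideal.sum_mem _ fun _ hs => Ideal.mul_mem_left _ _ (mem_mI z u hs)

/-- every element has a finite expansion with unit coefficients, supported in every monomial
ideal containing it -/
lemma exists_exp [IsAdicComplete (maximalIdeal A) A]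
    (hz : Ideal.span (insert z (Set.range u)) = maximalIdeal A) (hM : MonP z u) (g : A) :
    ∃ (T : Finset (Ex d)) (c : Ex d → A), (∀ s ∈ T, IsUnit (c s)) ∧
      g = ∑ s ∈ T, c s * monomial z u s := by
  classical
  set E : Set (Ex d) := {s | ∀ E' : Set (Ex d), IsUpperSet E' → g ∈ mI z u E' → s ∈ E'} with hEdef
  have hE : IsUpperSet E := fun a b hab ha E' h1 h2 => h1 hab (ha E' h1 h2)
  have hF : ∀ F : Finset (Ex d), (∀ s ∈ F, s ∉ E) → ∃ E' : Set (Ex d), IsUpperSet E' ∧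
      g ∈ mI z u E' ∧ ∀ s ∈ F, s ∉ E' := by
    intro F
    induction F using Finset.induction_on with
    | empty =>
      intro _
      refine ⟨Set.univ, isUpperSet_univ, ?_, by simp⟩
      refine mI_mono z u (Set.subset_univ _) (?_ : g ∈ mI z u (GG d 0))
      rw [← pow_eq_mI hz]; simp
    | insert s F hs ih =>
      intro hF
      obtain ⟨E1, h1, hg1, hF1⟩ := ih (fun t ht => hF t (Finset.mem_insert_of_mem ht))
      have hsE := hF s (Finset.mem_insert_self _ _)
      simp only [hEdef, Set.mem_ofPred_eq] at hsE
      push Not at hsE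
      obtain ⟨E2, h2, hg2, hs2⟩ := hsE
      refine ⟨E1 ∩ (E2 ∪ GG d (dg s + 1)), h1.inter (h2.union (GG_upper _ _)), ?_, ?_⟩
      · exact mI_inter hz hM h1 (h2.union (GG_upper _ _))
          ((GG_compl_finite d (dg s + 1)).subset (fun s hs h => hs.2 (Or.inr h))) hg1
          (mI_mono z u Set.subset_union_left hg2)
      · intro t ht hmem
        rcases Finset.mem_insert.1 ht with rfl | ht
        · rcases hmem.2 with h | h
          · exact hs2 h
          · have : dg t + 1 ≤ dg t := h
            omega
        · exact hF1 t ht hmem.1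
  have hgE : g ∈ mI z u E := by
    apply mI_closed hz hM hE
    intro n
    obtain ⟨E', h1, h2, h3⟩ := hF ((GG_compl_finite d n).toFinset.filter (· ∉ E))
      (fun s hs => (Finset.mem_filter.1 hs).2)
    refine mI_mono z u ?_ h2
    intro s hs
    by_contra hcon
    refine h3 s ?_ hs
    rw [Finset.mem_filter, Set.Finite.mem_toFinset]
    exact ⟨fun h => hcon (Or.inr h), fun h => hcon (Or.inl h)⟩
  obtain ⟨T, hTE, hT, hTmin⟩ := dickson E
  have hgT : g ∈ mI z u (T : Set (Ex d)) := mI_upper z u _ E hT hgE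
  obtain ⟨c, hc⟩ := mem_mI_finset T g hgT
  refine ⟨T, c, ?_, hc⟩
  intro s hs
  by_contra hcs
  have hup : IsUpperSet (E \ {s}) := by
    intro a b hab ha
    refine ⟨hE hab ha.1, ?_⟩
    rintro rfl
    exact ha.2 (hTmin _ hs a ha.1 hab)
  have hmem : g ∈ mI z u (E \ {s}) := by
    rw [hc, ← Finset.add_sum_erase T _ hs]
    apply mI_shrink hz E hE s (hTE hs) _ _ hcs
    refine mI_mono z u ?_ (sum_mem_mI (T.erase s) c)
    intro t ht
    rw [Finset.mem_coe, Finset.mem_erase] at ht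
    exact ⟨hTE ht.2, ht.1⟩
  exact (hTE hs (E \ {s}) hup hmem).2 rfl

lemma supp_subset (hM : MonP z u) (T : Finset (Ex d)) (c : Ex d → A) (hc : ∀ s ∈ T, IsUnit (c s))
    (E : Set (Ex d)) (hE : IsUpperSet E) (hg : ∑ s ∈ T, c s * monomial z u s ∈ mI z u E) :
    (T : Set (Ex d)) ⊆ E := by
  classical
  by_contra hcon
  have hne : ((T : Set (Ex d)) \ E).Nonempty := by
    rw [Set.nonempty_iff_ne_empty]
    intro h
    exact hcon (Set.sdiff_eq_empty.1 h)
  obtain ⟨s, hs⟩ := (T.finite_toSet.subset Set.sdiff_subset).exists_minimal hne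
  have hsT : s ∈ T := hs.1.1
  have hmem : c s * monomial z u s ∈ mI z u (E ∪ (T.erase s : Finset (Ex d))) := by
    have e : c s * monomial z u s = (∑ s ∈ T, c s * monomial z u s) -
        ∑ s ∈ T.erase s, c s * monomial z u s := by
      rw [← Finset.add_sum_erase T _ hsT]; ring
    rw [e]
    exact Ideal.sub_mem _ (mI_mono z u Set.subset_union_left hg)
      (mI_mono z u Set.subset_union_right (sum_mem_mI _ c))
  obtain ⟨e, he, hes⟩ := hM _ s _ (hc s hsT) hmem
  by_cases heE : e ∈ E
  · exact hs.1.2 (hE hes heE)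
  · have heT := he.resolve_left heE
    rw [Finset.mem_coe, Finset.mem_erase] at heT
    exact heT.1 (le_antisymm hes (hs.2 ⟨heT.2, heE⟩ hes))

end

/-! ### Part 5a: F-subsets and weights -/

def WW {d : ℕ} (Δ : Set (Fin d → ℝ)) (n : ℕ) : Set (Fin d → ℕ) :=
  {a | n = 0 ∨ (fun i => (a i : ℝ) / n) ∈ Δ}

lemma IsFSubset.up {d : ℕ} {Δ : Set (Fin d → ℝ)} (h : IsFSubset Δ) {x y : Fin d → ℝ}
    (hx : x ∈ Δ) (hxy : ∀ i, x i ≤ y i) : y ∈ Δ := by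
  have := h.2.2.2 x hx (y - x) (fun i => by simpa using hxy i)
  simpa using this

lemma WW_upper {d : ℕ} {Δ : Set (Fin d → ℝ)} (h : IsFSubset Δ) (n : ℕ) : IsUpperSet (WW Δ n) := by
  intro a b hab ha
  rcases ha with ha | ha
  · exact Or.inl ha
  · refine Or.inr (h.up ha fun i => ?_)
    have : (a i : ℝ) ≤ b i := by exact_mod_cast hab i
    gcongr

lemma WW_anti {d : ℕ} {Δ : Set (Fin d → ℝ)} (h : IsFSubset Δ) {n k : ℕ} (hnk : n ≤ k) :
    WW Δ k ⊆ WW Δ n := by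
  intro a ha
  by_cases hn : n = 0
  · exact Or.inl hn
  rcases ha with ha | ha
  · omega
  · refine Or.inr (h.up ha fun i => ?_)
    have h1 : (n : ℝ) ≤ k := by exact_mod_cast hnk
    have h2 : (0 : ℝ) < n := by exact_mod_cast Nat.pos_of_ne_zero hn
    gcongr

lemma WW_add {d : ℕ} {Δ : Set (Fin d → ℝ)} (h : IsFSubset Δ) {n k : ℕ} {a b : Fin d → ℕ}
    (ha : a ∈ WW Δ n) (hb : b ∈ WW Δ k) : a + b ∈ WW Δ (n + k) := by
  by_cases hn : n = 0
  · subst hn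
    rw [zero_add]
    exact WW_upper h k le_add_self hb
  by_cases hk : k = 0
  · subst hk
    exact WW_upper h n le_self_add ha
  have ha' := ha.resolve_left hn
  have hb' := hb.resolve_left hk
  right
  have h1 : (0 : ℝ) < n := by exact_mod_cast Nat.pos_of_ne_zero hn
  have h2 : (0 : ℝ) < k := by exact_mod_cast Nat.pos_of_ne_zero hk
  have := h.2.2.1 ha' hb' (show (0 : ℝ) ≤ n / (n + k) by positivity)
    (show (0 : ℝ) ≤ k / (n + k) by positivity) (by field_simp)
  convert this using 1
  funext i
  simp only [Pi.add_apply, Pi.smul_apply, smul_eq_mul]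
  push_cast
  field_simp

lemma WW_mono {d : ℕ} {Δ Δ' : Set (Fin d → ℝ)} (h : Δ ⊆ Δ') (n : ℕ) : WW Δ n ⊆ WW Δ' n := by
  rintro a (ha | ha)
  · exact Or.inl ha
  · exact Or.inr (h ha)

def EK {d : ℕ} (m : ℕ) (Δ : Set (Fin d → ℝ)) : Set (Ex d) := {s | s.1 ∈ WW Δ (m - s.2)}

lemma EK_iff {d : ℕ} {m : ℕ} {Δ : Set (Fin d → ℝ)} {s : Ex d} (hs : s.2 < m) :
    s ∈ EK m Δ ↔ projPoint m s ∈ Δ := by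
  have e : (fun i => (s.1 i : ℝ) / ((m - s.2 : ℕ) : ℝ)) = projPoint m s := by
    funext i
    rw [Nat.cast_sub hs.le]; rfl
  constructor
  · rintro (h | h)
    · omega
    · rwa [e] at h
  · intro h
    right
    rwa [e]

lemma EK_upper {d : ℕ} {Δ : Set (Fin d → ℝ)} (h : IsFSubset Δ) (m : ℕ) : IsUpperSet (EK m Δ) := by
  intro s t hst hs
  exact WW_upper h _ hst.1 (WW_anti h (Nat.sub_le_sub_left hst.2 m) hs)

lemma isFSubset_orthant (d : ℕ) : IsFSubset (orthant d) := by
  refine ⟨subset_rfl, ?_, ?_, ?_⟩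
  · have : orthant d = ⋂ i, {x | 0 ≤ x i} := by ext; simp [orthant]
    rw [this]
    exact isClosed_iInter fun i => isClosed_le continuous_const (continuous_apply i)
  · intro x hx y hy a b ha hb _ i
    have h1 := hx i
    have h2 := hy i
    simp only [Pi.add_apply, Pi.smul_apply, smul_eq_mul]
    positivity
  · intro v hv w hw i
    exact add_nonneg (hv i) (hw i)

lemma isFSubset_smallest {d : ℕ} {X : Set (Fin d → ℝ)} (hX : X ⊆ orthant d) :
    IsFSubset (smallestFSubset X) := by
  refine ⟨fun x hx => hx _ ⟨isFSubset_orthant d, hX⟩, ?_, ?_, ?_⟩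
  · exact isClosed_sInter fun Δ h => h.1.2.1
  · exact convex_sInter fun Δ h => h.1.2.2.1
  · intro v hv w hw Δ h
    exact h.1.2.2.2 v (hv Δ h) w hw

lemma subset_smallest {d : ℕ} (X : Set (Fin d → ℝ)) : X ⊆ smallestFSubset X :=
  fun _ hx _ h => h.2 hx

lemma smallest_subset {d : ℕ} {X Δ : Set (Fin d → ℝ)} (h : IsFSubset Δ) (hX : X ⊆ Δ) :
    smallestFSubset X ⊆ Δ := fun _ hx => hx _ ⟨h, hX⟩

lemma expPoints_orthant {d : ℕ} (m : ℕ) (s : Finset (Ex d)) : expPoints m s ⊆ orthant d := by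
  rintro _ ⟨ab, _, hlt, rfl⟩ i
  have : (ab.2 : ℝ) < m := by exact_mod_cast hlt
  unfold projPoint
  have h2 : (0 : ℝ) < m - ab.2 := by linarith
  positivity

section
variable {A : Type*} [CommRing A] {d : ℕ}

lemma deltaOf_fsubset (f z : A) (u : Fin d → A) (m : ℕ) : IsFSubset (DeltaOf f z u m) := by
  apply isFSubset_smallest
  intro x hx
  simp only [Set.mem_iUnion] at hx
  obtain ⟨c, _, hc⟩ := hx
  exact expPoints_orthant m _ hc

/-- unit expansions from finite sums -/
lemma exists_finsupp [Nontrivial A] (f z : A) (u : Fin d → A) (T : Finset (Ex d)) (c : Ex d → A)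
    (hc : ∀ s ∈ T, IsUnit (c s)) (hf : f = ∑ s ∈ T, c s * monomial z u s) :
    ∃ c' : (Ex d) →₀ A, IsUnitExpansion f z u c' ∧ c'.support = T := by
  classical
  refine ⟨Finsupp.onFinset T (fun s => if s ∈ T then c s else 0) (by intro s; simp; tauto), ?_⟩
  have hsupp : (Finsupp.onFinset T (fun s => if s ∈ T then c s else 0)
      (by intro s; simp; tauto)).support = T := by
    ext s
    simp only [Finsupp.mem_support_iff, Finsupp.onFinset_apply]
    constructor
    · intro h; by_contra hs; simp [hs] at h
    · intro h; simpa [h] using (hc s h).ne_zero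
  refine ⟨⟨?_, ?_⟩, hsupp⟩
  · intro s hs
    rw [hsupp] at hs
    simpa [hs] using hc s hs
  · rw [Finsupp.sum, hsupp, hf]
    apply Finset.sum_congr rfl
    intro s hs
    simp [hs]

variable [IsLocalRing A] {z : A} {u : Fin d → A}

lemma exp_subset_EK (m : ℕ) (f : A) (T : Finset (Ex d)) (c : Ex d → A)
    (hc : ∀ s ∈ T, IsUnit (c s)) (hf : f = ∑ s ∈ T, c s * monomial z u s) :
    expPoints m T ⊆ DeltaOf f z u m := by
  obtain ⟨c', hc', hs⟩ := exists_finsupp f z u T c hc hf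
  refine subset_trans ?_ (subset_smallest _)
  intro x hx
  simp only [Set.mem_iUnion]
  exact ⟨c', hc', by rw [hs]; exact hx⟩

lemma mem_K_of_exp (m : ℕ) (f : A) (T : Finset (Ex d)) (c : Ex d → A)
    (hf : f = ∑ s ∈ T, c s * monomial z u s) (Δ : Set (Fin d → ℝ)) (h : expPoints m T ⊆ Δ) :
    f ∈ mI z u (EK m Δ) := by
  rw [hf]
  refine mI_mono z u ?_ (sum_mem_mI T c)
  intro s hs
  by_cases hsm : s.2 < m
  · exact (EK_iff hsm).2 (h ⟨s, hs, hsm, rfl⟩)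
  · left; omega

lemma delta_le_of_mem (hM : MonP z u) (m : ℕ) (f : A) {Δ : Set (Fin d → ℝ)}
    (hΔ : IsFSubset Δ) (hf : f ∈ mI z u (EK m Δ)) : DeltaOf f z u m ⊆ Δ := by
  apply smallest_subset hΔ
  intro x hx
  simp only [Set.mem_iUnion] at hx
  obtain ⟨c, ⟨hc1, hc2⟩, s, hs, hsm, rfl⟩ := hx
  rw [hc2] at hf
  exact (EK_iff hsm).1 (supp_subset hM c.support c hc1 _ (EK_upper hΔ m) hf hs)

lemma delta_le_iff [IsAdicComplete (maximalIdeal A) A]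
    (hz : Ideal.span (insert z (Set.range u)) = maximalIdeal A) (hM : MonP z u) (m : ℕ) (f : A)
    {Δ : Set (Fin d → ℝ)} (hΔ : IsFSubset Δ) :
    DeltaOf f z u m ⊆ Δ ↔ f ∈ mI z u (EK m Δ) := by
  refine ⟨fun h => ?_, delta_le_of_mem hM m f hΔ⟩
  obtain ⟨T, c, hc, hf⟩ := exists_exp hz hM f
  exact mem_K_of_exp m f T c hf Δ ((exp_subset_EK m f T c hc hf).trans h)

lemma delta_eq_exp (hM : MonP z u) (m : ℕ) (f : A) (T : Finset (Ex d)) (c : Ex d → A)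
    (hc : ∀ s ∈ T, IsUnit (c s)) (hf : f = ∑ s ∈ T, c s * monomial z u s) :
    DeltaOf f z u m = smallestFSubset (expPoints m T) := by
  apply subset_antisymm
  · apply delta_le_of_mem hM m f (isFSubset_smallest (expPoints_orthant m T))
    exact mem_K_of_exp m f T c hf _ (subset_smallest _)
  · exact smallest_subset (deltaOf_fsubset f z u m) (exp_subset_EK m f T c hc hf)

end

/-! ### Part 5b: change of parameter -/

section
variable {A : Type*} [CommRing A] {d : ℕ}

def um (u : Fin d → A) (a : Fin d → ℕ) : A := ∏ i, u i ^ a i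

lemma um_add (u : Fin d → A) (a b : Fin d → ℕ) : um u (a + b) = um u a * um u b := by
  simp [um, pow_add, Finset.prod_mul_distrib]

lemma um_zero (u : Fin d → A) : um u 0 = 1 := by simp [um]

lemma um_nsmul (u : Fin d → A) (a : Fin d → ℕ) (k : ℕ) : um u (k • a) = um u a ^ k := by
  induction k with
  | zero => simp [um_zero]
  | succ k ih => rw [succ_nsmul, um_add, ih, pow_succ]

lemma monomial_eq (z : A) (u : Fin d → A) (s : Ex d) : monomial z u s = z ^ s.2 * um u s.1 := rfl

def UI (u : Fin d → A) (S : Set (Fin d → ℕ)) : Ideal A := Ideal.span (um u '' S)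

lemma UI_mono (u : Fin d → A) {S T : Set (Fin d → ℕ)} (h : S ⊆ T) : UI u S ≤ UI u T :=
  Ideal.span_mono (Set.image_mono h)

lemma mem_UI (u : Fin d → A) {S : Set (Fin d → ℕ)} {a : Fin d → ℕ} (h : a ∈ S) : um u a ∈ UI u S :=
  Ideal.subset_span ⟨a, h, rfl⟩

lemma UI_mul {u : Fin d → A} {S T V : Set (Fin d → ℕ)} {x y : A} (hx : x ∈ UI u S) (hy : y ∈ UI u T)
    (h : ∀ a ∈ S, ∀ b ∈ T, a + b ∈ V) : x * y ∈ UI u V := by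
  have h1 : x * y ∈ UI u S * UI u T := Ideal.mul_mem_mul hx hy
  have h2 : UI u S * UI u T ≤ UI u V := by
    unfold UI
    rw [Ideal.span_mul_span', Ideal.span_le]
    rintro _ ⟨_, ⟨a, ha, rfl⟩, _, ⟨b, hb, rfl⟩, rfl⟩
    exact Ideal.subset_span ⟨a + b, h a ha b hb, um_add u a b⟩
  exact h2 h1

lemma UI_pow {u : Fin d → A} {V : ℕ → Set (Fin d → ℕ)} {x : A} (hx : x ∈ UI u (V 1))
    (h0 : 0 ∈ V 0) (h : ∀ k, ∀ a ∈ V k, ∀ b ∈ V 1, a + b ∈ V (k + 1)) (k : ℕ) :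
    x ^ k ∈ UI u (V k) := by
  induction k with
  | zero => rw [pow_zero, ← um_zero u]; exact mem_UI u h0
  | succ k ih => rw [pow_succ]; exact UI_mul ih hx (h k)

lemma zpow_UI {z : A} {u : Fin d → A} {S : Set (Fin d → ℕ)} {E : Set (Ex d)} (j : ℕ) {x : A}
    (hx : x ∈ UI u S) (h : ∀ a ∈ S, (a, j) ∈ E) : z ^ j * x ∈ mI z u E := by
  have h1 : z ^ j * x ∈ Ideal.span {z ^ j} * UI u S :=
    Ideal.mul_mem_mul (Ideal.mem_span_singleton_self _) hx
  have h2 : Ideal.span {z ^ j} * UI u S ≤ mI z u E := by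
    unfold UI
    rw [Ideal.span_mul_span', Ideal.span_le]
    rintro _ ⟨_, rfl, _, ⟨b, hb, rfl⟩, rfl⟩
    exact Ideal.subset_span ⟨(b, j), h b hb, rfl⟩
  exact h2 h1

lemma UI_le_mI {z : A} {u : Fin d → A} {S : Set (Fin d → ℕ)} {E : Set (Ex d)}
    (h : ∀ a ∈ S, (a, 0) ∈ E) : UI u S ≤ mI z u E := by
  intro x hx
  have := zpow_UI (z := z) 0 hx h
  simpa using this

lemma span_eq_UI (u : Fin d → A) : Ideal.span (Set.range u) = UI u {a | a ≠ 0} := by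
  apply le_antisymm
  · rw [Ideal.span_le]
    rintro _ ⟨i, rfl⟩
    have : u i = um u (Pi.single i 1) := by
      unfold um
      rw [Finset.prod_eq_single i]
      · simp
      · intro j _ hj; simp [hj]
      · simp
    rw [this]
    refine mem_UI u ?_
    simp [Set.mem_ofPred_eq]
  · unfold UI
    rw [Ideal.span_le]
    rintro _ ⟨a, ha, rfl⟩
    obtain ⟨i, hi⟩ := Function.ne_iff.1 ha
    have h1 : u i ∣ um u a :=
      (dvd_pow_self (u i) hi).trans (Finset.dvd_prod_of_mem (fun i => u i ^ a i) (Finset.mem_univ i))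
    exact Ideal.mem_of_dvd _ h1 (Ideal.subset_span ⟨i, rfl⟩)

/-- Lemma L -/
lemma mI_shift {z z' : A} {u : Fin d → A} (m : ℕ) {Δ : Set (Fin d → ℝ)} (hΔ : IsFSubset Δ)
    (h : z' - z ∈ UI u (WW Δ 1)) : mI z u (EK m Δ) ≤ mI z' u (EK m Δ) := by
  set φ := z' - z with hφ
  have hz : z = z' + (-φ) := by rw [hφ]; ring
  have hpow : ∀ k, (-φ) ^ k ∈ UI u (WW Δ k) := UI_pow (V := fun k => WW Δ k) (neg_mem h)
    (Or.inl rfl) (fun k a ha b hb => WW_add hΔ ha hb)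
  conv_lhs => unfold mI
  rw [Ideal.span_le]
  rintro _ ⟨⟨a, b⟩, hs, rfl⟩
  rw [monomial_eq, SetLike.mem_coe, hz, add_pow, Finset.sum_mul]
  refine Ideal.sum_mem _ fun j hj => ?_
  have hj' : j ≤ b := by simpa [Nat.lt_succ_iff] using hj
  have h1 : (-φ) ^ (b - j) * um u a ∈ UI u (WW Δ (m - j)) := by
    refine UI_mul (hpow (b - j)) (mem_UI u (S := {a}) rfl) ?_
    rintro a' ha' _ rfl
    have h2 := WW_add hΔ ha' hs
    refine WW_anti hΔ ?_ h2
    simp only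
    omega
  have h2 := zpow_UI (z := z') (E := EK m Δ) j h1 (fun a ha => ha)
  have h3 := Ideal.mul_mem_left _ ((b.choose j : ℕ) : A) h2
  convert h3 using 1
  simp only
  ring

lemma mI_unit {z e : A} (he : IsUnit e) (u : Fin d → A) (E : Set (Ex d)) :
    mI (e * z) u E = mI z u E := by
  have key : ∀ (z e : A), mI (e * z) u E ≤ mI z u E := by
    intro z e
    conv_lhs => unfold mI
    rw [Ideal.span_le]
    rintro _ ⟨s, hs, rfl⟩
    have : monomial (e * z) u s = e ^ s.2 * monomial z u s := by
      simp only [monomial_eq, mul_pow]; ring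
    rw [SetLike.mem_coe, this]
    exact Ideal.mul_mem_left _ _ (mem_mI z u hs)
  apply le_antisymm (key z e)
  obtain ⟨e', he'⟩ := he.exists_left_inv
  have := key (e * z) e'
  rwa [← mul_assoc, he', one_mul] at this

end

section
variable {A : Type*} [CommRing A] [IsLocalRing A] {d : ℕ}

def RS (u : Fin d → A) (z : A) : Prop := Ideal.span (insert z (Set.range u)) = maximalIdeal A

lemma span_ins (u : Fin d → A) (z : A) : Ideal.span (insert z (Set.range u)) =
    Ideal.span {z} ⊔ Ideal.span (Set.range u) := Ideal.span_insert _ _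

lemma RS_shift {u : Fin d → A} {z φ : A} (hz : RS u z) (hφ : φ ∈ Ideal.span (Set.range u)) :
    RS u (z + φ) := by
  unfold RS at *
  rw [← hz, span_ins, span_ins]
  have key : ∀ (z φ : A), φ ∈ Ideal.span (Set.range u) →
      Ideal.span {z + φ} ⊔ Ideal.span (Set.range u) ≤ Ideal.span {z} ⊔ Ideal.span (Set.range u) := by
    intro z φ hφ
    refine sup_le ?_ le_sup_right
    rw [Ideal.span_singleton_le_iff_mem]
    exact Submodule.add_mem_sup (Ideal.mem_span_singleton_self z) hφ
  apply le_antisymm (key z φ hφ)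
  have := key (z + φ) (-φ) (neg_mem hφ)
  rwa [add_neg_cancel_right] at this

lemma RS_unit {u : Fin d → A} {z e : A} (hz : RS u z) (he : IsUnit e) : RS u (e * z) := by
  unfold RS at *
  rw [← hz, span_ins, span_ins, Ideal.span_singleton_mul_left_unit he]

lemma not_mem_u {u : Fin d → A} {z e : A} (hM : MonP z u) (he : IsUnit e) :
    e * z ∉ Ideal.span (Set.range u) := by
  intro h
  rw [span_eq_UI] at h
  have h1 : e * monomial z u (0, 1) ∈ mI z u {s | s.1 ≠ 0} := by
    have : monomial z u (0, 1) = z := by simp [monomial_eq, um_zero]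
    rw [this]
    have hle : UI u {a | a ≠ 0} ≤ mI z u {s | s.1 ≠ 0} := UI_le_mI (fun a ha => ha)
    exact hle h
  obtain ⟨s, hs, hle⟩ := hM _ _ _ he h1
  exact hs (le_antisymm hle.1 (zero_le))

variable [IsAdicComplete (maximalIdeal A) A]

lemma change_param {u : Fin d → A} (hMon : ∀ z, RS u z → MonP z u) {z z' : A} (hz : RS u z)
    (hz' : RS u z') : ∃ (e : A) (S : Finset (Fin d → ℕ)) (c : (Fin d → ℕ) → A), IsUnit e ∧
      (∀ a ∈ S, IsUnit (c a)) ∧ 0 ∉ S ∧ e * z' = z + ∑ a ∈ S, c a * um u a := by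
  classical
  obtain ⟨T, c, hc, hT⟩ := exists_exp hz (hMon z hz) z'
  have hz'M : z' ∈ maximalIdeal A := by rw [← hz']; exact Ideal.subset_span (Set.mem_insert _ _)
  have hT1 : (T : Set (Ex d)) ⊆ GG d 1 := by
    apply supp_subset (hMon z hz) T c hc _ (GG_upper d 1)
    rw [← hT, ← pow_eq_mI hz, pow_one]; exact hz'M
  set T0 := T.filter (fun s => s.2 = 0) with hT0
  set T1 := T.filter (fun s => ¬ s.2 = 0) with hT1'
  set e := ∑ s ∈ T1, c s * monomial z u (s.1, s.2 - 1) with he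
  have hsum1 : ∑ s ∈ T1, c s * monomial z u s = e * z := by
    rw [he, Finset.sum_mul]
    refine Finset.sum_congr rfl fun s hs => ?_
    have hs2 : s.2 ≠ 0 := (Finset.mem_filter.1 hs).2
    obtain ⟨k, hk⟩ := Nat.exists_eq_succ_of_ne_zero hs2
    simp only [monomial_eq, hk, Nat.succ_eq_add_one, Nat.add_sub_cancel, pow_succ]
    ring
  set S := T0.image Prod.fst with hS
  have hsum0 : ∑ s ∈ T0, c s * monomial z u s = ∑ a ∈ S, c (a, 0) * um u a := by
    rw [hS, Finset.sum_image]
    · refine Finset.sum_congr rfl fun s hs => ?_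
      have hs2 : s.2 = 0 := (Finset.mem_filter.1 hs).2
      have : s = (s.1, 0) := by rw [← hs2]
      rw [monomial_eq, hs2, pow_zero, one_mul, ← this]
    · intro s hs t ht hst
      exact Prod.ext hst (by rw [(Finset.mem_filter.1 hs).2, (Finset.mem_filter.1 ht).2])
  have hz'eq : z' = e * z + ∑ a ∈ S, c (a, 0) * um u a := by
    rw [← hsum0, ← hsum1, add_comm, hT0, hT1', Finset.sum_filter_add_sum_filter_not]
    exact hT
  have hSmem : ∀ a ∈ S, (a, 0) ∈ T := by
    intro a ha
    obtain ⟨s, hs, rfl⟩ := Finset.mem_image.1 ha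
    obtain ⟨h1, h2⟩ := Finset.mem_filter.1 hs
    rw [← h2]; exact h1
  have hS0 : 0 ∉ S := by
    intro h
    have := hT1 (hSmem 0 h)
    simp [GG, dg, Set.mem_ofPred_eq] at this
  have hw : ∑ a ∈ S, c (a, 0) * um u a ∈ Ideal.span (Set.range u) := by
    rw [span_eq_UI]
    exact Ideal.sum_mem _ fun a ha => Ideal.mul_mem_left _ _ (mem_UI u (fun h => hS0 (h ▸ ha)))
  have heu : IsUnit e := by
    by_contra hne
    have hzM : z ∈ Ideal.span {z'} ⊔ Ideal.span (Set.range u) := by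
      rw [← span_ins, hz', ← hz]; exact Ideal.subset_span (Set.mem_insert _ _)
    obtain ⟨x, hx, w, hw2, hxw⟩ := Submodule.mem_sup.1 hzM
    obtain ⟨α, rfl⟩ := Ideal.mem_span_singleton'.1 hx
    have h1 : IsUnit (1 - α * e) := by
      apply IsLocalRing.isUnit_one_sub_self_of_mem_nonunits
      exact (mem_maximalIdeal _).1 (Ideal.mul_mem_left _ _ ((mem_maximalIdeal _).2 hne))
    apply not_mem_u (hMon z hz) h1
    have : (1 - α * e) * z = α * ∑ a ∈ S, c (a, 0) * um u a + w := by
      have h3 : α * z' = α * (e * z) + α * ∑ a ∈ S, c (a, 0) * um u a := by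
        rw [← mul_add, ← hz'eq]
      linear_combination h3 - hxw
    rw [this]
    exact Ideal.add_mem _ (Ideal.mul_mem_left _ _ hw) hw2
  obtain ⟨e', he'⟩ := heu.exists_left_inv
  have he'u : IsUnit e' := IsUnit.of_mul_eq_one _ he'
  refine ⟨e', S, fun a => e' * c (a, 0), he'u, fun a ha => he'u.mul (hc _ (hSmem a ha)), hS0, ?_⟩
  conv_lhs => rw [hz'eq]
  rw [mul_add, ← mul_assoc, he', one_mul, Finset.mul_sum]
  simp only [mul_assoc]

end

/-! ### Part 5c: the key contradiction -/

lemma sep_point {d : ℕ} {K : Set (Fin d → ℝ)} (hK : IsFSubset K) {x : Fin d → ℝ} (hx : x ∉ K) :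
    ∃ (L : Fin d → ℝ) (l : ℝ), (∀ i, 0 ≤ L i) ∧ ∑ i, L i * x i < l ∧
      ∀ y ∈ K, l ≤ ∑ i, L i * y i := by
  rcases K.eq_empty_or_nonempty with rfl | ⟨p, hp⟩
  · exact ⟨0, 1, fun i => le_rfl, by simp, fun y hy => by simp at hy⟩
  obtain ⟨g, l, h1, h2⟩ := geometric_hahn_banach_point_closed hK.2.2.1 hK.2.1 hx
  have hg : ∀ y : Fin d → ℝ, g y = ∑ i, g (Pi.single i 1) * y i := by
    intro y
    conv_lhs => rw [pi_eq_sum_univ' y]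
    rw [map_sum]
    refine Finset.sum_congr rfl fun i _ => ?_
    rw [map_smul, smul_eq_mul, mul_comm]
  refine ⟨fun i => g (Pi.single i 1), l, ?_, by rw [← hg]; exact h1, fun y hy => by
    rw [← hg]; exact (h2 y hy).le⟩
  intro i
  by_contra! hneg
  have hlp := h2 p hp
  set t : ℝ := (g p - l) / (- g (Pi.single i 1)) with ht
  have ht0 : 0 ≤ t := div_nonneg (by linarith) (by linarith)
  have := h2 (p + t • Pi.single i 1) (hK.2.2.2 p hp _ (fun j => by
    simp only [Pi.smul_apply, smul_eq_mul]
    refine mul_nonneg ht0 ?_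
    by_cases h : j = i
    · subst h; simp
    · simp [h]))
  rw [map_add, map_smul, smul_eq_mul] at this
  have h3 : t * g (Pi.single i 1) = -(g p - l) := by
    have hne : g (Pi.single i 1) ≠ 0 := hneg.ne
    rw [ht, div_neg, neg_mul, div_mul_cancel₀ _ hne]
  linarith

section
variable {A : Type*} [CommRing A] {d : ℕ}

lemma lead_pow {Γ : Type*} [AddCommMonoid Γ] [LinearOrder Γ] [IsOrderedCancelAddMonoid Γ]
    (w : (Fin d → ℕ) →+ Γ) {u : Fin d → A} {a0 : Fin d → ℕ} {c ψ : A}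
    (hψ : ψ ∈ UI u {a | w a0 < w a}) (m : ℕ) :
    (c * um u a0 + ψ) ^ m - c ^ m * um u (m • a0) ∈ UI u {a | m • w a0 < w a} := by
  have hφ : c * um u a0 + ψ ∈ UI u {a | w a0 ≤ w a} := by
    refine Ideal.add_mem _ (Ideal.mul_mem_left _ _ (mem_UI u (le_refl (w a0)))) ?_
    exact UI_mono u (fun a (ha : w a0 < w a) => ha.le) hψ
  induction m with
  | zero => simp [um_zero]
  | succ k ih =>
    have e1 : (c * um u a0 + ψ) ^ (k + 1) - c ^ (k + 1) * um u ((k + 1) • a0) =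
        ((c * um u a0 + ψ) ^ k - c ^ k * um u (k • a0)) * (c * um u a0 + ψ) +
          c ^ k * (um u (k • a0) * ψ) := by
      rw [succ_nsmul, um_add]; ring
    rw [e1]
    refine Ideal.add_mem _ (UI_mul ih hφ ?_) (Ideal.mul_mem_left _ _
      (UI_mul (mem_UI u (S := {k • a0}) rfl) hψ ?_))
    · intro a ha b hb
      rw [Set.mem_ofPred_eq] at *
      rw [map_add, succ_nsmul]
      exact add_lt_add_of_lt_of_le ha hb
    · rintro _ rfl b hb
      rw [Set.mem_ofPred_eq] at *
      rw [map_add, succ_nsmul, map_nsmul]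
      exact add_lt_add_of_le_of_lt le_rfl hb

end

section
variable {A : Type*} [CommRing A] [IsLocalRing A] {d : ℕ}

lemma keyB_core {Γ : Type*} [AddCommMonoid Γ] [LinearOrder Γ] [IsOrderedCancelAddMonoid Γ]
    (w : (Fin d → ℕ) →+ Γ) (hwpos : ∀ a, a ≠ 0 → 0 < w a)
    {u : Fin d → A} {z z' f : A} {m : ℕ} (hM' : MonP z' u)
    (T : Finset (Ex d)) (C : Ex d → A) (hC : ∀ s ∈ T, IsUnit (C s))
    (hf : f = ∑ s ∈ T, C s * monomial z u s) (h0m : ((0 : Fin d → ℕ), m) ∈ T)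
    (V : Set (Fin d → ℕ)) (hf' : f ∈ Ideal.span {z'} ⊔ UI u V) (hV : IsUpperSet V)
    {a0 : Fin d → ℕ} (ha0 : a0 ≠ 0) {c ψ : A} (hc : IsUnit c)
    (hψ : ψ ∈ UI u {a | w a0 < w a}) (hz' : z' = z + (c * um u a0 + ψ))
    (hT : ∀ s ∈ T, s.2 < m → (m - s.2) • w a0 < w s.1) : m • a0 ∈ V := by
  classical
  have hw0 : ∀ a, 0 ≤ w a := by
    intro a
    by_cases h : a = 0
    · rw [h, map_zero]
    · exact (hwpos a h).le
  have hwmono : ∀ a b, a ≤ b → w a ≤ w b := by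
    intro a b hab
    obtain ⟨k, rfl⟩ := exists_add_of_le hab
    rw [map_add]
    exact le_add_of_nonneg_right (hw0 k)
  set φ := c * um u a0 + ψ with hφ
  have hz : z = z' - φ := by rw [hz']; ring
  set W : Set (Fin d → ℕ) := {a | m • w a0 < w a} with hW
  -- reduction modulo z'
  have hmod : ∀ s : Ex d, monomial z u s - (-φ) ^ s.2 * um u s.1 ∈ Ideal.span {z'} := by
    intro s
    rw [monomial_eq, ← sub_mul]
    apply Ideal.mul_mem_right
    rw [Ideal.mem_span_singleton]
    have := sub_dvd_pow_sub_pow z (-φ) s.2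
    rwa [show z - -φ = z' by rw [hz]; ring] at this
  have hφ1 : -φ ∈ UI u {a | (1 : ℕ) • w a0 ≤ w a} := by
    apply neg_mem
    refine Ideal.add_mem _ (Ideal.mul_mem_left _ _ (mem_UI u ?_)) ?_
    · rw [Set.mem_ofPred_eq, one_nsmul]
    · refine UI_mono u (fun a (ha : w a0 < w a) => ?_) hψ
      rw [Set.mem_ofPred_eq, one_nsmul]; exact ha.le
  have hφk : ∀ k : ℕ, (-φ) ^ k ∈ UI u {a | k • w a0 ≤ w a} := by
    refine UI_pow (V := fun k => {a | k • w a0 ≤ w a}) hφ1 ?_ ?_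
    · simp [Set.mem_ofPred_eq]
    · intro k a ha b hb
      rw [Set.mem_ofPred_eq] at *
      rw [map_add, add_nsmul]
      exact add_le_add ha hb
  have hterm : ∀ s ∈ T, s ≠ (0, m) → (-φ) ^ s.2 * um u s.1 ∈ UI u W := by
    intro s hs hne
    refine UI_mul (hφk s.2) (mem_UI u (S := {s.1}) rfl) ?_
    rintro a ha _ rfl
    rw [Set.mem_ofPred_eq] at ha
    rw [hW, Set.mem_ofPred_eq, map_add]
    by_cases hsm : s.2 < m
    · have h1 := hT s hs hsm
      have h2 : m • w a0 = s.2 • w a0 + (m - s.2) • w a0 := by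
        rw [← add_nsmul]; congr 1; omega
      rw [h2]
      exact add_lt_add_of_le_of_lt ha h1
    · push Not at hsm
      have h2 : m • w a0 ≤ s.2 • w a0 := nsmul_le_nsmul_left (hw0 a0) hsm
      by_cases hs1 : s.1 = 0
      · have hlt : m < s.2 := by
          rcases hsm.lt_or_eq with h | h
          · exact h
          · exact absurd (Prod.ext hs1 h.symm) hne
        have h3 : m • w a0 < s.2 • w a0 := nsmul_lt_nsmul_left (hwpos a0 ha0) hlt
        exact (h3.trans_le ha).trans_le (le_add_of_nonneg_right (hw0 _))
      · exact (h2.trans ha).trans_lt (lt_add_of_pos_right _ (hwpos _ hs1))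
  have hlead : C (0, m) * ((-1) ^ m * c ^ m) * um u (m • a0) ∈ Ideal.span {z'} ⊔ UI u (V ∪ W) := by
    set D := C (0, m)
    have h1 : f - ∑ s ∈ T, C s * ((-φ) ^ s.2 * um u s.1) ∈ Ideal.span {z'} := by
      rw [hf, ← Finset.sum_sub_distrib]
      refine Ideal.sum_mem _ fun s _ => ?_
      rw [← mul_sub]
      exact Ideal.mul_mem_left _ _ (hmod s)
    have h2 : ∑ s ∈ T.erase (0, m), C s * ((-φ) ^ s.2 * um u s.1) ∈ UI u W :=
      Ideal.sum_mem _ fun s hs => Ideal.mul_mem_left _ _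
        (hterm s (Finset.mem_of_mem_erase hs) (Finset.ne_of_mem_erase hs))
    have h3 : D * (φ ^ m - c ^ m * um u (m • a0)) * (-1) ^ m ∈ UI u W :=
      Ideal.mul_mem_right _ _ (Ideal.mul_mem_left _ _ (lead_pow w hψ m))
    have h4 := Finset.add_sum_erase T (fun s => C s * ((-φ) ^ s.2 * um u s.1)) h0m
    simp only [um_zero, mul_one] at h4
    have e : D * ((-1) ^ m * c ^ m) * um u (m • a0) =
        f + (-(f - ∑ s ∈ T, C s * ((-φ) ^ s.2 * um u s.1))) +
        (- (∑ s ∈ T.erase (0, m), C s * ((-φ) ^ s.2 * um u s.1)) -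
          D * (φ ^ m - c ^ m * um u (m • a0)) * (-1) ^ m) := by
      rw [← h4, neg_pow φ m]
      ring
    rw [e]
    have hU1 : UI u V ≤ UI u (V ∪ W) := UI_mono u Set.subset_union_left
    have hU2 : UI u W ≤ UI u (V ∪ W) := UI_mono u Set.subset_union_right
    have hle1 : Ideal.span {z'} ⊔ UI u V ≤ Ideal.span {z'} ⊔ UI u (V ∪ W) :=
      sup_le_sup_left hU1 _
    have hle2 : UI u W ≤ Ideal.span {z'} ⊔ UI u (V ∪ W) := hU2.trans le_sup_right
    have hle3 : Ideal.span {z'} ≤ Ideal.span {z'} ⊔ UI u (V ∪ W) := le_sup_left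
    exact Ideal.add_mem _ (Ideal.add_mem _ (hle1 hf') (hle3 (neg_mem h1)))
      (hle2 (sub_mem (neg_mem h2) h3))
  have hunit : IsUnit (C (0, m) * ((-1) ^ m * c ^ m)) :=
    (hC _ h0m).mul ((isUnit_one.neg.pow m).mul (hc.pow m))
  have hmem : C (0, m) * ((-1) ^ m * c ^ m) * monomial z' u (m • a0, 0) ∈
      mI z' u {s | 1 ≤ s.2 ∨ s.1 ∈ V ∪ W} := by
    have hle : Ideal.span {z'} ⊔ UI u (V ∪ W) ≤ mI z' u {s | 1 ≤ s.2 ∨ s.1 ∈ V ∪ W} := by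
      refine sup_le ?_ (UI_le_mI fun a ha => Or.inr ha)
      rw [Ideal.span_singleton_le_iff_mem]
      have hz1 : monomial z' u (0, 1) = z' := by simp [monomial_eq, um_zero]
      have hz2 : monomial z' u (0, 1) ∈ mI z' u {s | 1 ≤ s.2 ∨ s.1 ∈ V ∪ W} :=
        mem_mI z' u (Or.inl le_rfl)
      rwa [hz1] at hz2
    have e : monomial z' u (m • a0, 0) = um u (m • a0) := by simp [monomial_eq]
    rw [e]
    exact hle hlead
  obtain ⟨s, hs, hle⟩ := hM' _ _ _ hunit hmem
  rcases hs with hs | hs | hs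
  · have := hle.2
    simp only at this
    omega
  · exact hV hle.1 hs
  · exfalso
    have h1 := hwmono _ _ hle.1
    rw [hW, Set.mem_ofPred_eq] at hs
    simp only [map_nsmul] at h1
    exact absurd hs (not_lt.2 h1)

end

def lexW {d : ℕ} (L : Fin d → ℝ) : (Fin d → ℕ) →+ (ℝ ×ₗ Lex (Fin d → ℕ)) where
  toFun a := toLex (∑ i, L i * (a i : ℝ), toLex a)
  map_zero' := by simp
  map_add' a b := by
    simp only [Pi.add_apply, Nat.cast_add, mul_add, Finset.sum_add_distrib]
    rfl

lemma lexW_lt_of {d : ℕ} {L : Fin d → ℝ} {a b : Fin d → ℕ}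
    (h : ∑ i, L i * (a i : ℝ) < ∑ i, L i * (b i : ℝ)) : lexW L a < lexW L b :=
  Prod.Lex.toLex_lt_toLex.2 (Or.inl h)

lemma lexW_inj {d : ℕ} (L : Fin d → ℝ) : Function.Injective (lexW L) := by
  intro a b h
  have h1 : (ofLex (lexW L a)).2 = (ofLex (lexW L b)).2 := by rw [h]
  exact h1

lemma lexW_pos {d : ℕ} {L : Fin d → ℝ} (hL : ∀ i, 0 ≤ L i) {a : Fin d → ℕ} (ha : a ≠ 0) :
    0 < lexW L a := by
  have h0 : 0 ≤ ∑ i, L i * (a i : ℝ) := Finset.sum_nonneg fun i _ => mul_nonneg (hL i) (by positivity)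
  apply Prod.Lex.toLex_lt_toLex.2
  rcases h0.lt_or_eq with h | h
  · exact Or.inl h
  · refine Or.inr ⟨h, ?_⟩
    refine lt_of_le_of_ne ?_ ?_
    · exact Pi.toLex_monotone (zero_le (a := a))
    · intro h; exact ha h.symm


/-! ### Part 5d: existence of a minimal parameter -/

section
variable {A : Type*} [CommRing A] [IsLocalRing A] {d : ℕ}

lemma zero_m_mem {u : Fin d → A} {z f : A} {m : ℕ} (hz : RS u z) (hM : MonP z u)
    (hf1 : f ∈ (maximalIdeal A) ^ m ⊔ Ideal.span (Set.range u))
    (hf2 : f ∉ (maximalIdeal A) ^ (m + 1) ⊔ Ideal.span (Set.range u))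
    (T : Finset (Ex d)) (C : Ex d → A) (hC : ∀ s ∈ T, IsUnit (C s))
    (hf : f = ∑ s ∈ T, C s * monomial z u s) : ((0 : Fin d → ℕ), m) ∈ T := by
  have hzM : z ∈ maximalIdeal A := by rw [← hz]; exact Ideal.subset_span (Set.mem_insert _ _)
  have hle : (maximalIdeal A) ^ m ⊔ Ideal.span (Set.range u) ≤
      mI z u {s | s.1 ≠ 0 ∨ m ≤ s.2} := by
    refine sup_le ?_ ?_
    · rw [pow_eq_mI hz]
      apply mI_mono
      intro s hs
      by_cases h : s.1 = 0
      · right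
        simpa [GG, dg, h, Set.mem_ofPred_eq] using hs
      · exact Or.inl h
    · rw [span_eq_UI]
      exact UI_le_mI fun a ha => Or.inl ha
  have hup : IsUpperSet {s : Ex d | s.1 ≠ 0 ∨ m ≤ s.2} := by
    rintro s t hst (h | h)
    · left
      intro h0
      exact h (le_antisymm (hst.1.trans (le_of_eq h0)) zero_le)
    · exact Or.inr (h.trans hst.2)
  have hT := supp_subset hM T C hC _ hup (hf ▸ hle hf1)
  by_contra hnot
  apply hf2
  rw [hf]
  refine Ideal.sum_mem _ fun s hs => Ideal.mul_mem_left _ _ ?_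
  by_cases h : s.1 = 0
  · have h2 : m ≤ s.2 := (hT hs).resolve_left (fun h' => h' h)
    have h3 : m ≠ s.2 := by
      rintro rfl
      exact hnot (h ▸ hs)
    have hle2 : (maximalIdeal A) ^ (m + 1) ≤ (maximalIdeal A) ^ (m + 1) ⊔ Ideal.span (Set.range u) :=
      le_sup_left
    apply hle2
    rw [monomial_eq]
    apply Ideal.mul_mem_right
    exact Ideal.pow_le_pow_right (show m + 1 ≤ s.2 by omega) (Ideal.pow_mem_pow hzM _)
  · have hle2 : Ideal.span (Set.range u) ≤ (maximalIdeal A) ^ (m + 1) ⊔ Ideal.span (Set.range u) :=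
      le_sup_right
    apply hle2
    rw [monomial_eq, span_eq_UI]
    exact Ideal.mul_mem_left _ _ (mem_UI u h)

lemma mI_EK_le (u : Fin d → A) (z : A) (m : ℕ) (Δ : Set (Fin d → ℝ)) :
    mI z u (EK m Δ) ≤ Ideal.span {z} ⊔ UI u (WW Δ m) := by
  conv_lhs => unfold mI
  rw [Ideal.span_le]
  rintro _ ⟨⟨a, b⟩, hs, rfl⟩
  rw [SetLike.mem_coe, monomial_eq]
  by_cases hb : b = 0
  · subst hb
    have hle : UI u (WW Δ m) ≤ Ideal.span {z} ⊔ UI u (WW Δ m) := le_sup_right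
    apply hle
    exact Ideal.mul_mem_left _ _ (mem_UI u hs)
  · have hle : Ideal.span {z} ≤ Ideal.span {z} ⊔ UI u (WW Δ m) := le_sup_left
    apply hle
    exact Ideal.mul_mem_right _ _ (Ideal.mem_span_singleton.2 (dvd_pow_self z hb))

variable [IsAdicComplete (maximalIdeal A) A]

lemma keyB {u : Fin d → A} (hMon : ∀ z, RS u z → MonP z u) {z z' f : A} {m : ℕ} (hm : 1 ≤ m)
    (hf1 : f ∈ (maximalIdeal A) ^ m ⊔ Ideal.span (Set.range u))
    (hf2 : f ∉ (maximalIdeal A) ^ (m + 1) ⊔ Ideal.span (Set.range u))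
    (hz : RS u z) (hz' : RS u z') (S : Finset (Fin d → ℕ)) (c : (Fin d → ℕ) → A)
    (hc : ∀ a ∈ S, IsUnit (c a)) (h0 : 0 ∉ S) (heq : z' = z + ∑ a ∈ S, c a * um u a)
    (hS : ∀ a ∈ S, a ∉ WW (DeltaOf f z u m) 1) (hS' : ∀ a ∈ S, a ∉ WW (DeltaOf f z' u m) 1) :
    S = ∅ := by
  classical
  by_contra hne
  obtain ⟨a1, ha1⟩ := Finset.nonempty_iff_ne_empty.2 hne
  have hK := deltaOf_fsubset f z u m
  have hK' := deltaOf_fsubset f z' u m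
  have ha1' : (fun i => (a1 i : ℝ)) ∉ DeltaOf f z u m := by
    intro h
    apply hS a1 ha1
    right
    simpa using h
  obtain ⟨L, l, hL, hLa, hLK⟩ := sep_point hK ha1'
  obtain ⟨a0, ha0, hmin⟩ := Finset.exists_min_image S (lexW L) ⟨a1, ha1⟩
  obtain ⟨T, C, hC, hT⟩ := exists_exp hz (hMon z hz) f
  have hLa0 : ∑ i, L i * (a0 i : ℝ) < l := by
    by_contra! hcon
    exact absurd (hmin a1 ha1) (not_le.2 (lexW_lt_of (lt_of_lt_of_le hLa hcon)))
  have hfK' : f ∈ mI z' u (EK m (DeltaOf f z' u m)) :=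
    (delta_le_iff hz' (hMon z' hz') m f hK').1 subset_rfl
  have ha0ne : a0 ≠ 0 := fun h => h0 (h ▸ ha0)
  have hmem := keyB_core (lexW L) (fun a ha => lexW_pos hL ha) (hMon z' hz') T C hC hT
    (zero_m_mem hz (hMon z hz) hf1 hf2 T C hC hT) (WW (DeltaOf f z' u m) m)
    (mI_EK_le u z' m _ hfK') (WW_upper hK' m) ha0ne (hc a0 ha0)
    (ψ := ∑ a ∈ S.erase a0, c a * um u a)
    (Ideal.sum_mem _ fun a ha => Ideal.mul_mem_left _ _ (mem_UI u (by
      rw [Set.mem_ofPred_eq]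
      refine lt_of_le_of_ne (hmin a (Finset.mem_of_mem_erase ha)) fun h => ?_
      exact Finset.ne_of_mem_erase ha (lexW_inj L h).symm)))
    (by rw [heq, Finset.add_sum_erase S (fun a => c a * um u a) ha0])
    (by
      intro s hs hsm
      rw [← map_nsmul]
      apply lexW_lt_of
      have h1 : projPoint m s ∈ DeltaOf f z u m := exp_subset_EK m f T C hC hT ⟨s, hs, hsm, rfl⟩
      have h2 := hLK _ h1
      have hpos : (0 : ℝ) < m - s.2 := by
        have : (s.2 : ℝ) < m := by exact_mod_cast hsm
        linarith
      have h3 : ∑ i, L i * projPoint m s i = (∑ i, L i * (s.1 i : ℝ)) / (m - s.2) := by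
        rw [Finset.sum_div]
        refine Finset.sum_congr rfl fun i _ => ?_
        simp only [projPoint]
        ring
      rw [h3, le_div_iff₀ hpos] at h2
      have h4 : ∑ i, L i * ((((m - s.2) • a0) i : ℕ) : ℝ) = (m - s.2) * ∑ i, L i * (a0 i : ℝ) := by
        rw [Finset.mul_sum]
        refine Finset.sum_congr rfl fun i _ => ?_
        simp only [Pi.smul_apply, smul_eq_mul, Nat.cast_mul, Nat.cast_sub hsm.le]
        ring
      rw [h4]
      nlinarith)
  apply hS' a0 ha0
  right
  have h5 := hmem.resolve_left (by omega)
  have hm0 : (m : ℝ) ≠ 0 := by exact_mod_cast (show m ≠ 0 by omega)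
  convert h5 using 2 with i
  simp only [Pi.smul_apply, smul_eq_mul, Nat.cast_mul, Nat.cast_one, div_one]
  field_simp

lemma delta_shift {u : Fin d → A} (hMon : ∀ z, RS u z → MonP z u) {z z' f : A} {m : ℕ}
    (hz : RS u z) (hz' : RS u z') (h : z' - z ∈ UI u (WW (DeltaOf f z u m) 1)) :
    DeltaOf f z' u m ⊆ DeltaOf f z u m := by
  have hK := deltaOf_fsubset f z u m
  rw [delta_le_iff hz' (hMon z' hz') m f hK]
  exact mI_shift m hK h ((delta_le_iff hz (hMon z hz) m f hK).1 subset_rfl)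

lemma delta_unit {u : Fin d → A} (hMon : ∀ z, RS u z → MonP z u) {z e f : A} {m : ℕ}
    (hz : RS u z) (he : IsUnit e) : DeltaOf f (e * z) u m ⊆ DeltaOf f z u m := by
  have hK := deltaOf_fsubset f z u m
  have hz' := RS_unit hz he
  rw [delta_le_iff hz' (hMon _ hz') m f hK, mI_unit he]
  exact (delta_le_iff hz (hMon z hz) m f hK).1 subset_rfl

lemma sum_um_mem {u : Fin d → A} (S : Finset (Fin d → ℕ)) (c : (Fin d → ℕ) → A)
    (V : Set (Fin d → ℕ)) (h : ∀ a ∈ S, a ∈ V) : ∑ a ∈ S, c a * um u a ∈ UI u V :=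
  Ideal.sum_mem _ fun a ha => Ideal.mul_mem_left _ _ (mem_UI u (h a ha))

lemma sum_um_mem_span {u : Fin d → A} (S : Finset (Fin d → ℕ)) (c : (Fin d → ℕ) → A)
    (h : 0 ∉ S) : ∑ a ∈ S, c a * um u a ∈ Ideal.span (Set.range u) := by
  rw [span_eq_UI]
  exact sum_um_mem S c _ fun a ha h0 => h (h0 ▸ ha)

/-- directedness -/
lemma meet {u : Fin d → A} (hMon : ∀ z, RS u z → MonP z u) {z z' f : A} {m : ℕ} (hm : 1 ≤ m)
    (hf1 : f ∈ (maximalIdeal A) ^ m ⊔ Ideal.span (Set.range u))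
    (hf2 : f ∉ (maximalIdeal A) ^ (m + 1) ⊔ Ideal.span (Set.range u))
    (hz : RS u z) (hz' : RS u z') :
    ∃ (S : Finset (Fin d → ℕ)) (c : (Fin d → ℕ) → A) (z'' : A), 0 ∉ S ∧
      (∀ a ∈ S, a ∈ WW (DeltaOf f z u m) 1) ∧ z'' = z + ∑ a ∈ S, c a * um u a ∧ RS u z'' ∧
      DeltaOf f z'' u m ⊆ DeltaOf f z u m ∧ DeltaOf f z'' u m ⊆ DeltaOf f z' u m := by
  classical
  obtain ⟨e, S, c, he, hc, h0, heq⟩ := change_param hMon hz hz'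
  set S1 := S.filter (fun a => a ∈ WW (DeltaOf f z u m) 1) with hS1
  set Sr := S.filter (fun a => ¬ a ∈ WW (DeltaOf f z u m) 1) with hSr
  set S2 := Sr.filter (fun a => a ∈ WW (DeltaOf f (e * z') u m) 1) with hS2
  set S3 := Sr.filter (fun a => ¬ a ∈ WW (DeltaOf f (e * z') u m) 1) with hS3
  have hsplit1 : ∑ a ∈ S1, c a * um u a + ∑ a ∈ Sr, c a * um u a = ∑ a ∈ S, c a * um u a :=
    Finset.sum_filter_add_sum_filter_not S _ _
  have hsplit2 : ∑ a ∈ S2, c a * um u a + ∑ a ∈ S3, c a * um u a = ∑ a ∈ Sr, c a * um u a :=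
    Finset.sum_filter_add_sum_filter_not Sr _ _
  have hS1S : S1 ⊆ S := Finset.filter_subset _ _
  have hSrS : Sr ⊆ S := Finset.filter_subset _ _
  have hS2S : S2 ⊆ S := (Finset.filter_subset _ _).trans hSrS
  have hS3S : S3 ⊆ S := (Finset.filter_subset _ _).trans hSrS
  set z1 := z + ∑ a ∈ S1, c a * um u a with hz1
  set z2 := e * z' + -∑ a ∈ S2, c a * um u a with hz2
  have hez' : RS u (e * z') := RS_unit hz' he
  have hRz1 : RS u z1 := RS_shift hz (sum_um_mem_span S1 c fun h => h0 (hS1S h))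
  have hRz2 : RS u z2 := RS_shift hez' (neg_mem (sum_um_mem_span S2 c fun h => h0 (hS2S h)))
  have hd1 : DeltaOf f z1 u m ⊆ DeltaOf f z u m := by
    apply delta_shift hMon hz hRz1
    rw [hz1, add_sub_cancel_left]
    exact sum_um_mem S1 c _ fun a ha => (Finset.mem_filter.1 ha).2
  have hd2 : DeltaOf f z2 u m ⊆ DeltaOf f (e * z') u m := by
    apply delta_shift hMon hez' hRz2
    rw [hz2, add_sub_cancel_left]
    exact neg_mem (sum_um_mem S2 c _ fun a ha => (Finset.mem_filter.1 ha).2)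
  have hz12 : z2 = z1 + ∑ a ∈ S3, c a * um u a := by
    rw [hz2, hz1, heq, ← hsplit1, ← hsplit2]; ring
  have hS3e : S3 = ∅ := by
    refine keyB hMon hm hf1 hf2 hRz1 hRz2 S3 c (fun a ha => hc a (hS3S ha))
      (fun h => h0 (hS3S h)) hz12 ?_ ?_
    · intro a ha h
      exact (Finset.mem_filter.1 (Finset.mem_filter.1 ha).1).2 (WW_mono hd1 1 h)
    · intro a ha h
      exact (Finset.mem_filter.1 ha).2 (WW_mono hd2 1 h)
  rw [hS3e, Finset.sum_empty, add_zero] at hz12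
  refine ⟨S1, c, z1, fun h => h0 (hS1S h), fun a ha => (Finset.mem_filter.1 ha).2, rfl, hRz1, hd1, ?_⟩
  rw [← hz12]
  exact hd2.trans (delta_unit hMon hz' he)

def PP (u : Fin d → A) (f : A) (m N : ℕ) (z : A) : Set (Ex d) :=
  {s | s.2 < m ∧ ∑ i, s.1 i ≤ N ∧ s ∈ EK m (DeltaOf f z u m)}

lemma PP_finite (u : Fin d → A) (f : A) (m N : ℕ) (z : A) : (PP u f m N z).Finite := by
  refine (GG_compl_finite d (m + N)).subset ?_
  rintro s ⟨h1, h2, -⟩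
  simp only [GG, dg, Set.mem_compl_iff, Set.mem_ofPred_eq]
  omega

lemma PP_mono {u : Fin d → A} {f : A} {m : ℕ} (N : ℕ) {z z' : A}
    (h : DeltaOf f z u m ⊆ DeltaOf f z' u m) : PP u f m N z ⊆ PP u f m N z' := by
  rintro s ⟨h1, h2, h3⟩
  exact ⟨h1, h2, WW_mono h _ h3⟩

def MinN (u : Fin d → A) (f : A) (m N : ℕ) (z : A) : Prop :=
  RS u z ∧ ∀ z', RS u z' → PP u f m N z ⊆ PP u f m N z'

lemma exists_minN {u : Fin d → A} (hMon : ∀ z, RS u z → MonP z u) {f : A} {m : ℕ} (hm : 1 ≤ m)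
    (hf1 : f ∈ (maximalIdeal A) ^ m ⊔ Ideal.span (Set.range u))
    (hf2 : f ∉ (maximalIdeal A) ^ (m + 1) ⊔ Ideal.span (Set.range u))
    (hex : ∃ z, RS u z) (N : ℕ) : ∃ z, MinN u f m N z := by
  classical
  have hne : ∃ k, ∃ z, RS u z ∧ (PP u f m N z).ncard = k := by
    obtain ⟨z, hz⟩ := hex
    exact ⟨_, z, hz, rfl⟩
  obtain ⟨z, hz, hk⟩ := Nat.find_spec hne
  refine ⟨z, hz, fun z' hz' => ?_⟩
  obtain ⟨S, c, z'', -, -, -, hR, hd1, hd2⟩ := meet hMon hm hf1 hf2 hz hz'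
  have h1 : (PP u f m N z).ncard ≤ (PP u f m N z'').ncard := by
    rw [hk]
    exact Nat.find_min' hne ⟨z'', hR, rfl⟩
  have h2 := Set.eq_of_subset_of_ncard_le (PP_mono N hd1) h1 (PP_finite u f m N z)
  rw [← h2]
  exact PP_mono N hd2

lemma minN_step {u : Fin d → A} (hMon : ∀ z, RS u z → MonP z u) {f : A} {m : ℕ} (hm : 1 ≤ m)
    (hf1 : f ∈ (maximalIdeal A) ^ m ⊔ Ideal.span (Set.range u))
    (hf2 : f ∉ (maximalIdeal A) ^ (m + 1) ⊔ Ideal.span (Set.range u))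
    {N : ℕ} {y : A} (hy : MinN u f m N y) :
    ∃ y', MinN u f m (N + 1) y' ∧ y' - y ∈ (maximalIdeal A) ^ (N + 1) ∧
      y' - y ∈ UI u (WW (DeltaOf f y u m) 1 ∩ {a | a ≠ 0}) ∧
      DeltaOf f y' u m ⊆ DeltaOf f y u m := by
  classical
  obtain ⟨x, hx⟩ := exists_minN hMon hm hf1 hf2 ⟨y, hy.1⟩ (N + 1)
  obtain ⟨S, c, w, h0, hS, hw, hR, hd1, hd2⟩ := meet hMon hm hf1 hf2 hy.1 hx.1
  set S1 := S.filter (fun a => ∑ i, a i ≤ N) with hS1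
  set S2 := S.filter (fun a => ¬ ∑ i, a i ≤ N) with hS2
  have hsplit : ∑ a ∈ S1, c a * um u a + ∑ a ∈ S2, c a * um u a = ∑ a ∈ S, c a * um u a :=
    Finset.sum_filter_add_sum_filter_not S _ _
  have hS1S : S1 ⊆ S := Finset.filter_subset _ _
  have hS2S : S2 ⊆ S := Finset.filter_subset _ _
  set y' := w + -∑ a ∈ S1, c a * um u a with hy'
  have hRy' : RS u y' := RS_shift hR (neg_mem (sum_um_mem_span S1 c fun h => h0 (hS1S h)))
  have hdy' : DeltaOf f y' u m ⊆ DeltaOf f w u m := by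
    apply delta_shift hMon hR hRy'
    rw [hy', add_sub_cancel_left]
    refine neg_mem (sum_um_mem S1 c _ fun a ha => ?_)
    have hP : ((a, m - 1) : Ex d) ∈ PP u f m N y := by
      refine ⟨?_, (Finset.mem_filter.1 ha).2, ?_⟩
      · simp only; omega
      · show a ∈ WW _ (m - (m - 1))
        rw [show m - (m - 1) = 1 by omega]
        exact hS a (hS1S ha)
    have h2 : a ∈ WW _ (m - (m - 1)) := (hy.2 w hR hP).2.2
    rwa [show m - (m - 1) = 1 by omega] at h2
  have hdiff : y' - y = ∑ a ∈ S2, c a * um u a := by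
    rw [hy', hw, ← hsplit]; ring
  refine ⟨y', ⟨hRy', fun z' hz' => ?_⟩, ?_, ?_, hdy'.trans hd1⟩
  · exact (PP_mono _ (hdy'.trans hd2)).trans (hx.2 z' hz')
  · rw [hdiff]
    refine Ideal.sum_mem _ fun a ha => Ideal.mul_mem_left _ _ ?_
    have h1 : N + 1 ≤ ∑ i, a i := by
      have := (Finset.mem_filter.1 ha).2
      omega
    have h2 := monomial_mem_pow hy.1 (a, 0)
    rw [monomial_eq, pow_zero, one_mul] at h2
    refine Ideal.pow_le_pow_right ?_ h2
    simpa [dg] using h1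
  · rw [hdiff]
    exact sum_um_mem S2 c _ fun a ha => ⟨hS a (hS2S ha), fun h => h0 (hS2S (h ▸ ha))⟩

theorem exists_min {u : Fin d → A} (hMon : ∀ z, RS u z → MonP z u) {f : A} {m : ℕ} (hm : 1 ≤ m)
    (hf1 : f ∈ (maximalIdeal A) ^ m ⊔ Ideal.span (Set.range u))
    (hf2 : f ∉ (maximalIdeal A) ^ (m + 1) ⊔ Ideal.span (Set.range u))
    (hex : ∃ z, RS u z) :
    ∃ z, RS u z ∧ ∀ z', RS u z' → DeltaOf f z u m ⊆ DeltaOf f z' u m := by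
  classical
  obtain ⟨y0, hy0⟩ := exists_minN hMon hm hf1 hf2 hex 0
  have hstep : ∀ (N : ℕ) (y : {y // MinN u f m N y}), ∃ y' : {y // MinN u f m (N + 1) y},
      y'.1 - y.1 ∈ (maximalIdeal A) ^ (N + 1) ∧
      y'.1 - y.1 ∈ UI u (WW (DeltaOf f y.1 u m) 1 ∩ {a | a ≠ 0}) ∧
      DeltaOf f y'.1 u m ⊆ DeltaOf f y.1 u m := by
    rintro N ⟨y, hy⟩
    obtain ⟨y', h1, h2⟩ := minN_step hMon hm hf1 hf2 hy
    exact ⟨⟨y', h1⟩, h2⟩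
  choose g hg using hstep
  let Y : (N : ℕ) → {y // MinN u f m N y} := fun N => Nat.rec ⟨y0, hy0⟩ (fun k y => g k y) N
  have hY : ∀ N, Y (N + 1) = g N (Y N) := fun N => rfl
  have hY1 : ∀ N, (Y (N + 1)).1 - (Y N).1 ∈ (maximalIdeal A) ^ (N + 1) := by
    intro N; rw [hY]; exact (hg N (Y N)).1
  have hY2 : ∀ N, (Y (N + 1)).1 - (Y N).1 ∈ UI u (WW (DeltaOf f (Y N).1 u m) 1 ∩ {a | a ≠ 0}) := by
    intro N; rw [hY]; exact (hg N (Y N)).2.1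
  have hY3 : ∀ N, DeltaOf f (Y (N + 1)).1 u m ⊆ DeltaOf f (Y N).1 u m := by
    intro N; rw [hY]; exact (hg N (Y N)).2.2
  have hanti : ∀ N k, DeltaOf f (Y (N + k)).1 u m ⊆ DeltaOf f (Y N).1 u m := by
    intro N k
    induction k with
    | zero => exact subset_rfl
    | succ k ih => exact (hY3 (N + k)).trans ih
  have hdiff : ∀ N k, (Y (N + k)).1 - (Y N).1 ∈
      UI u (WW (DeltaOf f (Y N).1 u m) 1 ∩ {a | a ≠ 0}) := by
    intro N k
    induction k with
    | zero => simp
    | succ k ih =>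
      have h1 := UI_mono u (Set.inter_subset_inter_left {a | a ≠ 0} (WW_mono (hanti N k) 1))
        (hY2 (N + k))
      have h2 := Ideal.add_mem _ h1 ih
      rwa [sub_add_sub_cancel] at h2
  obtain ⟨z, hzlim⟩ := adic_lim (fun N => (Y N).1)
    (fun N => Ideal.pow_le_pow_right (Nat.le_succ N) (hY1 N))
  have hzd : ∀ N, z - (Y N).1 ∈ UI u (WW (DeltaOf f (Y N).1 u m) 1 ∩ {a | a ≠ 0}) := by
    intro N
    set V := WW (DeltaOf f (Y N).1 u m) 1 ∩ {a | a ≠ 0} with hV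
    have hRN := (Y N).2.1
    have hup : IsUpperSet {s : Ex d | s.1 ∈ V} := by
      rintro s t hst ⟨h1, h2⟩
      refine ⟨WW_upper (deltaOf_fsubset _ _ _ _) 1 hst.1 h1, fun h => h2 ?_⟩
      exact le_antisymm (hst.1.trans (le_of_eq h)) zero_le
    have hmem : z - (Y N).1 ∈ mI (Y N).1 u {s : Ex d | s.1 ∈ V} := by
      apply mI_closed hRN (hMon _ hRN) hup
      intro n
      rw [mI_union, ← pow_eq_mI hRN]
      have e : z - (Y N).1 = ((Y (N + n)).1 - (Y N).1) + (z - (Y (N + n)).1) := by ring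
      rw [e]
      refine Submodule.add_mem_sup ?_ (Ideal.pow_le_pow_right (Nat.le_add_left n N) (hzlim (N + n)))
      have hle : UI u V ≤ mI (Y N).1 u {s : Ex d | s.1 ∈ V} := UI_le_mI fun a ha => ha
      exact hle (hdiff N n)
    have hle : mI (Y N).1 u {s : Ex d | s.1 ∈ V} ≤ UI u V := by
      unfold mI
      rw [Ideal.span_le]
      rintro _ ⟨s, hs, rfl⟩
      exact Ideal.mul_mem_left _ _ (mem_UI u hs)
    exact hle hmem
  have hRz : RS u z := by
    have := RS_shift (φ := z - (Y 0).1) (Y 0).2.1 (by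
      rw [span_eq_UI]
      exact UI_mono u Set.inter_subset_right (hzd 0))
    rwa [add_sub_cancel] at this
  have hdz : ∀ N, DeltaOf f z u m ⊆ DeltaOf f (Y N).1 u m := fun N =>
    delta_shift hMon (Y N).2.1 hRz (UI_mono u Set.inter_subset_left (hzd N))
  refine ⟨z, hRz, fun z' hz' => ?_⟩
  obtain ⟨T, C, hC, hT⟩ := exists_exp hRz (hMon z hRz) f
  rw [delta_eq_exp (hMon z hRz) m f T C hC hT]
  apply smallest_subset (deltaOf_fsubset _ _ _ _)
  rintro _ ⟨s, hs, hsm, rfl⟩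
  have h1 : projPoint m s ∈ DeltaOf f z u m := exp_subset_EK m f T C hC hT ⟨s, hs, hsm, rfl⟩
  have h2 : s ∈ PP u f m (∑ i, s.1 i) (Y (∑ i, s.1 i)).1 :=
    ⟨hsm, le_rfl, (EK_iff hsm).2 (hdz _ h1)⟩
  exact (EK_iff hsm).1 ((Y (∑ i, s.1 i)).2.2 z' hz' h2).2.2

end

/-! ### Part 6: finitely generated F-subsets are rational polyhedra -/

lemma exists_between_fin {α β : Type*} (P : Finset α) (N : Finset β) (l : α → ℝ) (r : β → ℝ)
    (h : ∀ p ∈ P, ∀ n ∈ N, l p ≤ r n) : ∃ t, (∀ p ∈ P, l p ≤ t) ∧ ∀ n ∈ N, t ≤ r n := by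
  rcases P.eq_empty_or_nonempty with rfl | hP
  · rcases N.eq_empty_or_nonempty with rfl | hN
    · exact ⟨0, by simp, by simp⟩
    · obtain ⟨n0, hn0, hmin⟩ := Finset.exists_min_image N r hN
      exact ⟨r n0, by simp, hmin⟩
  · obtain ⟨p0, hp0, hmax⟩ := Finset.exists_max_image P l hP
    exact ⟨l p0, hmax, fun n hn => h p0 hp0 n hn⟩

lemma fm_elim {Q X : Type*} [AddCommGroup Q] [Module ℚ Q] (ev : Q → X → ℝ)
    (hev : ∀ (a b : ℚ) (r s : Q) (x : X), ev (a • r + b • s) x = a * ev r x + b * ev s x)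
    (F : Finset (ℚ × Q)) : ∃ G : Finset Q, ∀ x, (∃ t : ℝ, ∀ q ∈ F, 0 ≤ (q.1 : ℝ) * t + ev q.2 x) ↔
      ∀ r ∈ G, 0 ≤ ev r x := by
  classical
  set P := F.filter (fun q => 0 < q.1) with hP
  set N := F.filter (fun q => q.1 < 0) with hN
  set Z := F.filter (fun q => q.1 = 0) with hZ
  refine ⟨Z.image Prod.snd ∪ (P ×ˢ N).image (fun pn => (-pn.2.1) • pn.1.2 + pn.1.1 • pn.2.2), ?_⟩
  intro x
  constructor
  · rintro ⟨t, ht⟩ r hr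
    rcases Finset.mem_union.1 hr with hr | hr
    · obtain ⟨q, hq, rfl⟩ := Finset.mem_image.1 hr
      obtain ⟨hqF, hq0⟩ := Finset.mem_filter.1 hq
      have := ht q hqF
      rw [hq0] at this
      simpa using this
    · obtain ⟨⟨p, n⟩, hpn, rfl⟩ := Finset.mem_image.1 hr
      obtain ⟨hp, hn⟩ := Finset.mem_product.1 hpn
      obtain ⟨hpF, hp0⟩ := Finset.mem_filter.1 hp
      obtain ⟨hnF, hn0⟩ := Finset.mem_filter.1 hn
      have h1 := ht p hpF
      have h2 := ht n hnF
      have hp0' : (0 : ℝ) < p.1 := by exact_mod_cast hp0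
      have hn0' : (n.1 : ℝ) < 0 := by exact_mod_cast hn0
      simp only [hev]
      push_cast
      have h3 := mul_nonneg (show (0 : ℝ) ≤ -n.1 by linarith) h1
      have h4 := mul_nonneg hp0'.le h2
      nlinarith
  · intro h
    obtain ⟨t, ht1, ht2⟩ := exists_between_fin P N (fun p => -(ev p.2 x) / p.1)
      (fun n => ev n.2 x / (-n.1)) (by
        intro p hp n hn
        have hr := h _ (Finset.mem_union_right _ (Finset.mem_image.2
          ⟨(p, n), Finset.mem_product.2 ⟨hp, hn⟩, rfl⟩))
        have hp0' : (0 : ℝ) < p.1 := by exact_mod_cast (Finset.mem_filter.1 hp).2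
        have hn0' : (n.1 : ℝ) < 0 := by exact_mod_cast (Finset.mem_filter.1 hn).2
        simp only [hev] at hr
        push_cast at hr
        rw [div_le_div_iff₀ hp0' (by linarith)]
        nlinarith)
    refine ⟨t, fun q hq => ?_⟩
    rcases lt_trichotomy q.1 0 with h0 | h0 | h0
    · have h1 := ht2 q (Finset.mem_filter.2 ⟨hq, h0⟩)
      have hn0' : (q.1 : ℝ) < 0 := by exact_mod_cast h0
      rw [le_div_iff₀ (by linarith)] at h1
      linarith
    · have h1 := h q.2 (Finset.mem_union_left _ (Finset.mem_image.2
        ⟨q, Finset.mem_filter.2 ⟨hq, h0⟩, rfl⟩))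
      rw [h0]
      simpa using h1
    · have h1 := ht1 q (Finset.mem_filter.2 ⟨hq, h0⟩)
      have hp0' : (0 : ℝ) < q.1 := by exact_mod_cast h0
      rw [div_le_iff₀ hp0'] at h1
      linarith

lemma fm_elim_k {Q X : Type*} [AddCommGroup Q] [Module ℚ Q] (ev : Q → X → ℝ)
    (hev : ∀ (a b : ℚ) (r s : Q) (x : X), ev (a • r + b • s) x = a * ev r x + b * ev s x) (k : ℕ) :
    ∀ (F : Finset ((Fin k → ℚ) × Q)), ∃ G : Finset Q, ∀ x,
      (∃ t : Fin k → ℝ, ∀ q ∈ F, 0 ≤ ∑ j, (q.1 j : ℝ) * t j + ev q.2 x) ↔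
      ∀ r ∈ G, 0 ≤ ev r x := by
  classical
  induction k with
  | zero =>
    intro F
    refine ⟨F.image Prod.snd, fun x => ?_⟩
    simp
  | succ k ih =>
    intro F
    obtain ⟨G1, hG1⟩ := fm_elim (Q := (Fin k → ℚ) × Q) (X := (Fin k → ℝ) × X)
      (fun q p => ∑ j, (q.1 j : ℝ) * p.1 j + ev q.2 p.2) (by
        intro a b r s x
        simp only [Prod.fst_add, Prod.smul_fst, Prod.snd_add, Prod.smul_snd, Pi.add_apply,
          Pi.smul_apply, smul_eq_mul, hev, Rat.cast_add, Rat.cast_mul, mul_add, Finset.mul_sum,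
          add_mul, Finset.sum_add_distrib, mul_assoc]
        ring)
      (F.image fun q => (q.1 0, (Fin.tail q.1, q.2)))
    obtain ⟨G, hG⟩ := ih G1
    refine ⟨G, fun x => ?_⟩
    rw [← hG]
    constructor
    · rintro ⟨t, ht⟩
      refine ⟨Fin.tail t, (hG1 (Fin.tail t, x)).1 ⟨t 0, ?_⟩⟩
      intro q hq
      obtain ⟨q', hq', rfl⟩ := Finset.mem_image.1 hq
      have := ht q' hq'
      rw [Fin.sum_univ_succ] at this
      simp only [Fin.tail]
      linarith
    · rintro ⟨t, ht⟩
      obtain ⟨t0, ht0⟩ := (hG1 (t, x)).2 ht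
      refine ⟨Fin.cons t0 t, fun q hq => ?_⟩
      have := ht0 _ (Finset.mem_image.2 ⟨q, hq, rfl⟩)
      rw [Fin.sum_univ_succ]
      simp only [Fin.tail] at this
      simp only [Fin.cons_zero, Fin.cons_succ]
      linarith

def hullUp {d k : ℕ} (p : Fin k → Fin d → ℚ) : Set (Fin d → ℝ) :=
  {x | ∃ t : Fin k → ℝ, (∀ j, 0 ≤ t j) ∧ ∑ j, t j = 1 ∧ ∀ i, ∑ j, t j * (p j i : ℝ) ≤ x i}

lemma hullUp_ineq {d k : ℕ} (p : Fin k → Fin d → ℚ) :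
    ∃ G : Finset ((Fin d → ℚ) × ℚ),
      hullUp p = {x | ∀ r ∈ G, 0 ≤ ∑ i, (r.1 i : ℝ) * x i + r.2} := by
  classical
  let F : Finset ((Fin k → ℚ) × ((Fin d → ℚ) × ℚ)) :=
    (Finset.univ.image fun j : Fin k => (Pi.single j 1, (0, 0))) ∪
    (Finset.univ.image fun i : Fin d => (fun j => - p j i, (Pi.single i 1, 0))) ∪
    {(1, (0, -1)), (-1, (0, 1))}
  obtain ⟨G, hG⟩ := fm_elim_k (Q := (Fin d → ℚ) × ℚ) (X := Fin d → ℝ)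
    (fun r x => ∑ i, (r.1 i : ℝ) * x i + r.2) (by
        intro a b r s x
        simp only [Prod.fst_add, Prod.smul_fst, Prod.snd_add, Prod.smul_snd, Pi.add_apply,
          Pi.smul_apply, smul_eq_mul, Rat.cast_add, Rat.cast_mul, mul_add, Finset.mul_sum,
          add_mul, Finset.sum_add_distrib, mul_assoc]
        ring) k F
  refine ⟨G, ?_⟩
  ext x
  rw [Set.mem_ofPred_eq, ← hG]
  have hsingle : ∀ {n : ℕ} (j : Fin n) (t : Fin n → ℝ),
      ∑ j', ((Pi.single j (1 : ℚ) : Fin n → ℚ) j' : ℝ) * t j' = t j := by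
    intro n j t
    rw [Finset.sum_eq_single j]
    · simp
    · intro b _ hb; simp [hb]
    · simp
  constructor
  · rintro ⟨t, h1, h2, h3⟩
    refine ⟨t, fun q hq => ?_⟩
    rcases Finset.mem_union.1 hq with hq | hq
    · rcases Finset.mem_union.1 hq with hq | hq
      · obtain ⟨j, _, rfl⟩ := Finset.mem_image.1 hq
        rw [hsingle]
        simpa using h1 j
      · obtain ⟨i, _, rfl⟩ := Finset.mem_image.1 hq
        rw [hsingle]
        have e : ∑ j, ((-p j i : ℚ) : ℝ) * t j = - ∑ j, t j * (p j i : ℝ) := by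
          rw [← Finset.sum_neg_distrib]
          refine Finset.sum_congr rfl fun j _ => ?_
          push_cast; ring
        rw [e]
        have := h3 i
        push_cast
        linarith
    · rcases Finset.mem_insert.1 hq with rfl | hq
      · simp [h2]
      · rw [Finset.mem_singleton.1 hq]
        simp [h2]
  · rintro ⟨t, ht⟩
    refine ⟨t, fun j => ?_, ?_, fun i => ?_⟩
    · have := ht _ (Finset.mem_union_left _ (Finset.mem_union_left _
        (Finset.mem_image.2 ⟨j, Finset.mem_univ j, rfl⟩)))
      rw [hsingle] at this
      simpa using this
    · have h1 := ht (1, (0, -1)) (Finset.mem_union_right _ (by simp))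
      have h2 := ht (-1, (0, 1)) (Finset.mem_union_right _ (by simp))
      simp at h1 h2
      linarith
    · have := ht _ (Finset.mem_union_left _ (Finset.mem_union_right _
        (Finset.mem_image.2 ⟨i, Finset.mem_univ i, rfl⟩)))
      rw [hsingle] at this
      have e : ∑ j, ((-p j i : ℚ) : ℝ) * t j = - ∑ j, t j * (p j i : ℝ) := by
        rw [← Finset.sum_neg_distrib]
        refine Finset.sum_congr rfl fun j _ => ?_
        push_cast; ring
      rw [e] at this
      push_cast at this
      linarith

lemma isFSubset_empty (d : ℕ) : IsFSubset (∅ : Set (Fin d → ℝ)) :=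
  ⟨Set.empty_subset _, isClosed_empty, convex_empty, fun _ h => absurd h (Set.notMem_empty _)⟩

lemma hullUp_fsubset {d k : ℕ} (p : Fin k → Fin d → ℚ) (hp : ∀ j i, 0 ≤ p j i) :
    IsFSubset (hullUp p) := by
  refine ⟨?_, ?_, ?_, ?_⟩
  · rintro x ⟨t, h1, h2, h3⟩ i
    refine le_trans (Finset.sum_nonneg fun j _ => mul_nonneg (h1 j) ?_) (h3 i)
    exact_mod_cast hp j i
  · obtain ⟨G, hG⟩ := hullUp_ineq p
    rw [hG]
    have : {x : Fin d → ℝ | ∀ r ∈ G, 0 ≤ ∑ i, (r.1 i : ℝ) * x i + r.2} =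
        ⋂ r ∈ G, {x | 0 ≤ ∑ i, (r.1 i : ℝ) * x i + r.2} := by
      ext x; simp
    rw [this]
    refine isClosed_biInter fun r _ => isClosed_le continuous_const ?_
    fun_prop
  · rintro x ⟨t, h1, h2, h3⟩ y ⟨s, g1, g2, g3⟩ a b ha hb hab
    refine ⟨a • t + b • s, fun j => ?_, ?_, fun i => ?_⟩
    · have := h1 j
      have := g1 j
      simp only [Pi.add_apply, Pi.smul_apply, smul_eq_mul]
      positivity
    · simp only [Pi.add_apply, Pi.smul_apply, smul_eq_mul, Finset.sum_add_distrib,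
        ← Finset.mul_sum, h2, g2, mul_one, hab]
    · simp only [Pi.add_apply, Pi.smul_apply, smul_eq_mul, add_mul, Finset.sum_add_distrib,
        mul_assoc, ← Finset.mul_sum]
      exact add_le_add (mul_le_mul_of_nonneg_left (h3 i) ha) (mul_le_mul_of_nonneg_left (g3 i) hb)
  · rintro v ⟨t, h1, h2, h3⟩ w hw
    refine ⟨t, h1, h2, fun i => (h3 i).trans ?_⟩
    exact le_add_of_nonneg_right (hw i)

lemma smallest_eq_hullUp {d k : ℕ} (p : Fin k → Fin d → ℚ) (hp : ∀ j i, 0 ≤ p j i) :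
    smallestFSubset (Set.range fun j i => (p j i : ℝ)) = hullUp p := by
  classical
  apply subset_antisymm
  · apply smallest_subset (hullUp_fsubset p hp)
    rintro _ ⟨j, rfl⟩
    refine ⟨Pi.single j 1, fun j' => ?_, by simp, fun i => le_of_eq ?_⟩
    · by_cases h : j' = j
      · subst h; simp
      · simp [h]
    · rw [Finset.sum_eq_single j]
      · simp
      · intro b _ hb; simp [hb]
      · simp
  · rintro x ⟨t, h1, h2, h3⟩ Δ ⟨hΔ, hsub⟩
    have hc := hΔ.2.2.1.sum_mem (t := Finset.univ) (w := t) (z := fun j i => (p j i : ℝ))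
      (fun j _ => h1 j) h2 (fun j _ => hsub ⟨j, rfl⟩)
    refine hΔ.up hc fun i => ?_
    simpa [Finset.sum_apply] using h3 i

lemma hullUp_rational {d k : ℕ} (p : Fin k → Fin d → ℚ) (hp : ∀ j i, 0 ≤ p j i) :
    IsRationalPolyhedron (hullUp p) := by
  classical
  have hF := hullUp_fsubset p hp
  rcases (hullUp p).eq_empty_or_nonempty with he | ⟨x0, hx0⟩
  · refine ⟨1, 0, fun _ _ => le_rfl, ?_⟩
    rw [he]
    symm
    rw [Set.eq_empty_iff_forall_notMem]
    rintro x ⟨_, h⟩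
    have := h 0
    simp at this
    linarith
  obtain ⟨G, hG⟩ := hullUp_ineq p
  have hpos : ∀ r ∈ G, ∀ i, 0 ≤ r.1 i := by
    intro r hr i
    by_contra! hneg
    have hneg' : (r.1 i : ℝ) < 0 := by exact_mod_cast hneg
    set v : ℝ := ∑ i, (r.1 i : ℝ) * x0 i + r.2 with hv
    have hv0 : 0 ≤ v := by
      have := hx0
      rw [hG] at this
      exact this r hr
    set t : ℝ := (v + 1) / (-(r.1 i : ℝ)) with ht
    have ht0 : 0 ≤ t := div_nonneg (by linarith) (by linarith)
    have hmem := hF.2.2.2 x0 hx0 (Pi.single i t) (fun j => by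
      by_cases h : j = i
      · subst h; simpa using ht0
      · simp [h])
    rw [hG] at hmem
    have h1 := hmem r hr
    have e : ∑ j, (r.1 j : ℝ) * (x0 + (Pi.single i t : Fin d → ℝ)) j =
        ∑ j, (r.1 j : ℝ) * x0 j + (r.1 i : ℝ) * t := by
      simp only [Pi.add_apply, mul_add, Finset.sum_add_distrib]
      congr 1
      rw [Finset.sum_eq_single i]
      · simp
      · intro b _ hb; simp [hb]
      · simp
    rw [e] at h1
    have h2 : (r.1 i : ℝ) * t = -(v + 1) := by
      have hne : (r.1 i : ℝ) ≠ 0 := hneg'.ne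
      rw [ht, div_neg, mul_neg, mul_div_cancel₀ _ hne]
    linarith
  set G' := G.filter (fun r => r.2 < 0) with hG'
  refine ⟨G'.card, fun j i => (G'.equivFin.symm j).1.1 i / (-(G'.equivFin.symm j).1.2), ?_, ?_⟩
  · intro j i
    obtain ⟨hr, hr0⟩ := Finset.mem_filter.1 (G'.equivFin.symm j).2
    exact div_nonneg (hpos _ hr i) (by linarith)
  · have key : ∀ (r : (Fin d → ℚ) × ℚ), r.2 < 0 → ∀ x : Fin d → ℝ,
        (1 ≤ ∑ i, ((r.1 i / (-r.2) : ℚ) : ℝ) * x i ↔ 0 ≤ ∑ i, (r.1 i : ℝ) * x i + r.2) := by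
      intro r hr x
      have hr' : (r.2 : ℝ) < 0 := by exact_mod_cast hr
      have e : ∑ i, ((r.1 i / (-r.2) : ℚ) : ℝ) * x i = (∑ i, (r.1 i : ℝ) * x i) / (-r.2) := by
        rw [Finset.sum_div]
        refine Finset.sum_congr rfl fun i _ => ?_
        push_cast; ring
      rw [e, le_div_iff₀ (by linarith)]
      constructor <;> intro h <;> linarith
    ext x
    constructor
    · intro hx
      refine ⟨hF.1 hx, fun j => ?_⟩
      obtain ⟨hr, hr0⟩ := Finset.mem_filter.1 (G'.equivFin.symm j).2
      rw [hG] at hx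
      exact (key _ hr0 x).2 (hx _ hr)
    · rintro ⟨hxo, hx⟩
      rw [hG]
      intro r hr
      by_cases hr0 : r.2 < 0
      · have := hx (G'.equivFin ⟨r, Finset.mem_filter.2 ⟨hr, hr0⟩⟩)
        simp only [Equiv.symm_apply_apply] at this
        exact (key r hr0 x).1 this
      · push Not at hr0
        have h1 : (0 : ℝ) ≤ r.2 := by exact_mod_cast hr0
        have h2 : 0 ≤ ∑ i, (r.1 i : ℝ) * x i := Finset.sum_nonneg fun i _ =>
          mul_nonneg (by exact_mod_cast hpos r hr i) (hxo i)
        linarith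

lemma smallest_exp_rational {d : ℕ} (m : ℕ) (T : Finset (Ex d)) :
    IsRationalPolyhedron (smallestFSubset (expPoints m T)) := by
  classical
  set T' := T.filter (fun s => s.2 < m) with hT'
  let p : Fin T'.card → Fin d → ℚ := fun j i =>
    ((T'.equivFin.symm j).1.1 i : ℚ) / ((m : ℚ) - ((T'.equivFin.symm j).1.2 : ℚ))
  have hp : ∀ j i, 0 ≤ p j i := by
    intro j i
    have h := (Finset.mem_filter.1 (T'.equivFin.symm j).2).2
    have h' : ((T'.equivFin.symm j).1.2 : ℚ) < m := by exact_mod_cast h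
    exact div_nonneg (by positivity) (by linarith)
  have e : expPoints m T = Set.range fun j i => (p j i : ℝ) := by
    have hpp : ∀ j, (fun i => (p j i : ℝ)) = projPoint m (T'.equivFin.symm j).1 := by
      intro j
      funext i
      simp only [p, projPoint]
      push_cast
      rfl
    ext x
    constructor
    · rintro ⟨s, hs, hsm, rfl⟩
      refine ⟨T'.equivFin ⟨s, Finset.mem_filter.2 ⟨hs, hsm⟩⟩, ?_⟩
      simp only [hpp, Equiv.symm_apply_apply]
    · rintro ⟨j, rfl⟩
      obtain ⟨h1, h2⟩ := Finset.mem_filter.1 (T'.equivFin.symm j).2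
      exact ⟨_, h1, h2, hpp j⟩
  rw [e, smallest_eq_hullUp p hp]
  exact hullUp_rational p hp

/-- **Proposition I.4 (Hironaka).** There exists `ŷ ∈ R̂` such that
`(ŷ, u_1, ..., u_d)` is a r.s.p. of `R̂` and `Δ(f; u; ŷ) = Δ(f; u)`; in particular the
characteristic polyhedron is a rational polyhedron. -/
theorem hironaka_characteristic_polyhedron
    {d : ℕ} (R : Type u) [CommRing R] [IsLocalRing R]
    (hreg : IsRegularLocalRing R) (y : R) (u : Fin d → R) (hrsp : IsRSP R y u)
    (f : R) (hfM : f ∈ maximalIdeal R) (hfu : f ∉ Ideal.span (Set.range u)) :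
    (∃ yh : Completion R, IsRSPhat R yh u ∧
      DeltaOf (cmpl f) yh (fun i => cmpl (u i)) (ordRes f u) = CharPolyhedron f u) ∧
    IsRationalPolyhedron (CharPolyhedron f u) := by
  have : IsNoetherianRing R := hreg.1
  have hspan : Ideal.span (insert y (Set.range u)) = maximalIdeal R := by
    have := hrsp.1
    rwa [Fin.range_cons] at this
  have hdim : ringKrullDim R = (d + 1 : ℕ) := hrsp.2
  have huM : Ideal.span (Set.range u) ≤ maximalIdeal R := by
    rw [← hspan]; exact Ideal.span_mono (Set.subset_insert _ _)
  obtain ⟨hm, hf1, hf2⟩ := ordRes_spec u huM f hfM hfu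
  have hRS : ∀ z : Completion R, RS (fun i => cmpl (u i)) z ↔ IsRSPhat R z u := by
    intro z
    unfold RS IsRSPhat
    rw [maxIdeal_hat]
  have hMon : ∀ z : Completion R, RS (fun i => cmpl (u i)) z → MonP z (fun i => cmpl (u i)) :=
    fun z hz => monP_completion u hdim z ((hRS z).1 hz)
  have := hat_complete (A := R)
  have hy : RS (fun i => cmpl (u i)) (cmpl y : Completion R) := by
    rw [hRS]
    unfold IsRSPhat
    have hmap := congrArg (Ideal.map (cmpl (R := R))) hspan
    rw [Ideal.map_span, Set.image_insert_eq, ← Set.range_comp] at hmap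
    exact hmap
  obtain ⟨yh, hyh, hmin⟩ := exists_min (f := cmpl f) hMon hm ((ord_hat u f _).2 hf1)
    (fun h => hf2 ((ord_hat u f _).1 h)) ⟨_, hy⟩
  have heq : DeltaOf (cmpl f) yh (fun i => cmpl (u i)) (ordRes f u) = CharPolyhedron f u := by
    apply subset_antisymm
    · intro x hx
      unfold CharPolyhedron
      simp only [Set.mem_iInter]
      intro z hz
      exact hmin z ((hRS z).2 hz) hx
    · intro x hx
      unfold CharPolyhedron at hx
      simp only [Set.mem_iInter] at hx
      exact hx yh ((hRS yh).1 hyh)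
  refine ⟨⟨yh, (hRS yh).1 hyh, heq⟩, ?_⟩
  obtain ⟨T, C, hC, hT⟩ := exists_exp hyh (hMon yh hyh) (cmpl f)
  rw [← heq, delta_eq_exp (hMon yh hyh) _ _ T C hC hT]
  exact smallest_exp_rational _ T

end CharPolyhedra
end
end

section
/- Let (R,M,k) be a regular local ring with regular system of parameters (y,u_1,...,u_d). Then every f ∈ R admits a finite sum expansion f = Σ_{(a,b)} C_{a,b} y^b u_1^{a_1}···u_d^{a_d}, with b ∈ ℕ, a ∈ ℕ^d, and each coefficient C_{a,b} a unit in R. -/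
/-!
Characteristic polyhedra of singularities without completion
(V. Cossart, O. Piltant), formalized statements.
-/

noncomputable section

open IsLocalRing TensorProduct

namespace CharPolyhedra

universe u v

/-! ### Monomial expansions and polyhedra -/

variable {R : Type u} [CommRing R]

/-- total degree of an exponent -/
def edeg {d : ℕ} (ab : (Fin d → ℕ) × ℕ) : ℕ := ab.2 + ∑ i, ab.1 i

lemma pow_le_span_monomial {d : ℕ} (y : R) (u : Fin d → R) (n : ℕ) :
    (Ideal.span (Set.range (Fin.cons y u : Fin (d+1) → R))) ^ n ≤
      Submodule.span R (monomial y u '' {m | edeg m = n}) := by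
  induction n with
  | zero =>
    intro r _
    have h1 : (1 : R) ∈ Submodule.span R (monomial y u '' {m | edeg m = 0}) :=
      Submodule.subset_span ⟨(0, 0), by simp [edeg], by simp [monomial]⟩
    simpa using Submodule.smul_mem _ r h1
  | succ n ih =>
    rw [pow_succ]
    refine (Ideal.mul_mono_left ih).trans ?_
    change Ideal.span _ * Ideal.span _ ≤ _
    rw [Ideal.span_mul_span']
    refine Submodule.span_le.2 ?_
    rintro _ ⟨_, ⟨m, hm, rfl⟩, _, ⟨i, rfl⟩, rfl⟩
    refine Submodule.subset_span ?_
    have hm' : edeg m = n := hm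
    refine Fin.cases ?_ (fun i => ?_) i
    · refine ⟨(m.1, m.2 + 1), ?_, ?_⟩
      · simp only [edeg, Set.mem_setOf_eq] at hm' ⊢; omega
      · simp only [monomial, Fin.cons_zero]; ring
    · refine ⟨(m.1 + Pi.single i 1, m.2), ?_, ?_⟩
      · simp only [edeg, Set.mem_setOf_eq, Pi.add_apply, Finset.sum_add_distrib] at hm' ⊢
        rw [Finset.sum_pi_single']
        simp; omega
      · simp only [monomial, Fin.cons_succ, Pi.add_apply, pow_add, Finset.prod_mul_distrib]
        have : ∏ j, u j ^ (Pi.single i 1 : Fin d → ℕ) j = u i := by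
          rw [Finset.prod_eq_single i]
          · simp
          · intro j _ hj; simp [Pi.single_eq_of_ne hj]
          · simp
        rw [this]; ring

/-- partial expansion up to order `n` -/
def Good [IsLocalRing R] {d : ℕ} (f y : R) (u : Fin d → R) (n : ℕ)
    (c : ((Fin d → ℕ) × ℕ) →₀ R) : Prop :=
  (∀ m ∈ c.support, IsUnit (c m)) ∧ (∀ m ∈ c.support, edeg m < n) ∧
    f - Finsupp.linearCombination R (monomial y u) c ∈ maximalIdeal R ^ n

lemma monomial_mem [IsLocalRing R] {d : ℕ} {y : R} {u : Fin d → R}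
    (h : Ideal.span (Set.range (Fin.cons y u : Fin (d+1) → R)) = maximalIdeal R)
    (m : (Fin d → ℕ) × ℕ) : monomial y u m ∈ maximalIdeal R ^ edeg m := by
  have hy : y ∈ maximalIdeal R := h ▸ Ideal.subset_span ⟨0, by simp⟩
  have hu : ∀ i, u i ∈ maximalIdeal R := fun i => h ▸ Ideal.subset_span ⟨i.succ, by simp⟩
  rw [edeg, pow_add]
  refine Ideal.mul_mem_mul (Ideal.pow_mem_pow hy _) ?_
  rw [← Finset.prod_pow_eq_pow_sum]
  exact Ideal.prod_mem_prod fun i _ => Ideal.pow_mem_pow (hu i) _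

lemma Good.succ [IsLocalRing R] {d : ℕ} {f y : R} {u : Fin d → R}
    (h : Ideal.span (Set.range (Fin.cons y u : Fin (d+1) → R)) = maximalIdeal R) {n : ℕ}
    {c : ((Fin d → ℕ) × ℕ) →₀ R} (hc : Good f y u n c) :
    ∃ c', Good f y u (n+1) c' ∧ c.support ⊆ c'.support := by
  classical
  obtain ⟨h1, h2, h3⟩ := hc
  have h4 := pow_le_span_monomial y u n (h.symm ▸ h3)
  obtain ⟨l, hl, hl'⟩ := (Finsupp.mem_span_image_iff_linearCombination R).1 h4
  have hl2 : ∀ m ∈ l.support, edeg m = n := fun m hm => (Finsupp.mem_supported R l).1 hl hm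
  have hsplit := Finsupp.filter_pos_add_filter_neg l (fun m => IsUnit (l m))
  set g := l.filter (fun m => IsUnit (l m)) with hg
  have hgs : ∀ m ∈ g.support, m ∈ l.support ∧ IsUnit (l m) := by
    intro m hm
    rw [hg, Finsupp.support_filter, Finset.mem_filter] at hm
    exact hm
  have hdisj : Disjoint c.support g.support := by
    rw [Finset.disjoint_left]
    intro m hm hm'
    have := h2 m hm
    have := hl2 m (hgs m hm').1
    omega
  have hsupp := Finsupp.support_add_eq hdisj
  refine ⟨c + g, ⟨?_, ?_, ?_⟩, ?_⟩
  · intro m hm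
    rw [hsupp, Finset.mem_union] at hm
    rcases hm with hm | hm
    · have := Finset.disjoint_left.1 hdisj hm
      rw [Finsupp.notMem_support_iff] at this
      simpa [this] using h1 m hm
    · have := Finset.disjoint_right.1 hdisj hm
      rw [Finsupp.notMem_support_iff] at this
      have h5 := (hgs m hm).2
      rw [Finsupp.add_apply, this, zero_add, hg, Finsupp.filter_apply_pos (fun m => IsUnit (l m)) _ h5]
      exact h5
  · intro m hm
    rw [hsupp, Finset.mem_union] at hm
    rcases hm with hm | hm
    · have := h2 m hm; omega
    · have := hl2 m (hgs m hm).1; omega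
  · rw [map_add, ← sub_sub, ← hl', ← hsplit, map_add, add_sub_cancel_left,
      Finsupp.linearCombination_apply]
    refine Ideal.sum_mem _ fun m hm => ?_
    rw [Finsupp.support_filter, Finset.mem_filter] at hm
    rw [Finsupp.filter_apply_pos (fun m => ¬ IsUnit (l m)) _ hm.2, pow_succ']
    change l m * monomial y u m ∈ _
    refine Ideal.mul_mem_mul ((mem_maximalIdeal _).2 hm.2) ?_
    rw [← hl2 m hm.1]
    exact monomial_mem h m
  · rw [hsupp]; exact Finset.subset_union_left

lemma Good.add [IsLocalRing R] {d : ℕ} {f y : R} {u : Fin d → R}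
    (h : Ideal.span (Set.range (Fin.cons y u : Fin (d+1) → R)) = maximalIdeal R) {n : ℕ}
    {c : ((Fin d → ℕ) × ℕ) →₀ R} (hc : Good f y u n c) (k : ℕ) :
    ∃ c', Good f y u (n+k) c' ∧ c.support ⊆ c'.support := by
  induction k with
  | zero => exact ⟨c, hc, subset_rfl⟩
  | succ k ih =>
    obtain ⟨c', h1, h2⟩ := ih
    obtain ⟨c'', h3, h4⟩ := h1.succ h
    exact ⟨c'', h3, h2.trans h4⟩

/-- **(1.1).** In a regular local ring with r.s.p. `(y, u_1, ..., u_d)`, every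
element admits a finite expansion `f = Σ C_{a,b} y^b u^a` with unit coefficients. -/
theorem exists_finite_unit_expansion
    {d : ℕ} (R : Type u) [CommRing R] [IsLocalRing R]
    (hreg : IsRegularLocalRing R) (y : R) (u : Fin d → R) (hrsp : IsRSP R y u) :
    ∀ f : R, ∃ c : ((Fin d → ℕ) × ℕ) →₀ R, IsUnitExpansion f y u c := by
  classical
  intro f
  obtain ⟨hN, -⟩ := hreg
  have h : Ideal.span (Set.range (Fin.cons y u : Fin (d+1) → R)) = maximalIdeal R := hrsp.1
  let I : (((Fin d → ℕ) × ℕ) →₀ R) → Ideal R := fun c =>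
    Submodule.span R (Set.range fun i : c.support => monomial y u i)
  obtain ⟨J, ⟨c, ⟨n, hc⟩, rfl⟩, hmax⟩ := set_has_maximal_iff_noetherian.2 hN
    (I '' {c | ∃ n, Good f y u n c}) ⟨_, 0, ⟨0, by simp [Good]⟩, rfl⟩
  have hmono : ∀ c c' : ((Fin d → ℕ) × ℕ) →₀ R, c.support ⊆ c'.support → I c ≤ I c' := by
    intro c c' hcc
    refine Submodule.span_mono ?_
    rintro _ ⟨i, rfl⟩
    exact ⟨⟨i, hcc i.2⟩, rfl⟩
  have hmem : ∀ c : ((Fin d → ℕ) × ℕ) →₀ R,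
      Finsupp.linearCombination R (monomial y u) c ∈ I c := by
    intro c
    rw [Finsupp.linearCombination_apply]
    exact Ideal.sum_mem _ fun m hm => Submodule.smul_mem _ _ (Submodule.subset_span ⟨⟨m, hm⟩, rfl⟩)
  obtain ⟨k, hk⟩ := (maximalIdeal R).exists_pow_inf_eq_pow_smul (I c ⊔ Ideal.span {f})
  obtain ⟨c', hc', hcc⟩ := hc.add h (k + 1)
  have hI : I c' = I c := by
    by_contra hne
    exact hmax _ ⟨c', ⟨_, hc'⟩, rfl⟩ (lt_of_le_of_ne (hmono _ _ hcc) (Ne.symm hne))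
  set r := f - Finsupp.linearCombination R (monomial y u) c' with hr
  have hfJ : f ∈ I c ⊔ Ideal.span {f} :=
    Ideal.mem_sup_right (Ideal.mem_span_singleton_self f)
  have hrJ : r ∈ maximalIdeal R • (I c ⊔ Ideal.span {f}) := by
    have h5 : r ∈ (maximalIdeal R ^ (k+1) • (⊤ : Ideal R)) ⊓ (I c ⊔ Ideal.span {f}) := by
      refine ⟨?_, Ideal.sub_mem _ hfJ (Ideal.mem_sup_left (hI ▸ hmem c'))⟩
      have := Ideal.pow_le_pow_right (show k + 1 ≤ n + (k+1) by omega) hc'.2.2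
      simpa using this
    rw [hk (k+1) (by omega)] at h5
    simp only [Nat.add_sub_cancel_left, pow_one] at h5
    exact Submodule.smul_mono le_rfl inf_le_right h5
  have hle : I c ⊔ Ideal.span {f} ≤ I c := by
    refine Submodule.le_of_le_smul_of_le_jacobson_bot (I := maximalIdeal R)
      (IsNoetherian.noetherian _) (IsLocalRing.maximalIdeal_le_jacobson _) ?_
    refine sup_le le_sup_left ?_
    rw [Ideal.span_singleton_le_iff_mem]
    have : f = Finsupp.linearCombination R (monomial y u) c' + r := by rw [hr]; ring
    rw [this]
    exact Submodule.add_mem_sup (hI ▸ hmem c') (this ▸ hrJ)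
  have hrI : r ∈ maximalIdeal R • I c' := hI ▸ Submodule.smul_mono le_rfl hle hrJ
  obtain ⟨a, ha, hsum⟩ := (Submodule.mem_ideal_smul_span_iff_exists_sum _ _ _).1 hrI
  refine ⟨c' + a.mapDomain Subtype.val, ?_, ?_⟩
  · intro m hm
    by_cases hmc : m ∈ c'.support
    · have h6 : a.mapDomain Subtype.val m = a ⟨m, hmc⟩ :=
        Finsupp.mapDomain_apply Subtype.val_injective a ⟨m, hmc⟩
      rw [Finsupp.add_apply, h6]
      by_contra hnu
      have h7 := Ideal.sub_mem _ ((mem_maximalIdeal _).2 hnu) (ha ⟨m, hmc⟩)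
      rw [add_sub_cancel_right] at h7
      exact (mem_maximalIdeal _).1 h7 (hc'.1 m hmc)
    · exfalso
      have h6 : a.mapDomain Subtype.val m = 0 :=
        Finsupp.mapDomain_notin_range _ _ (by simpa using hmc)
      rw [Finsupp.mem_support_iff, Finsupp.add_apply, h6, Finsupp.notMem_support_iff.1 hmc] at hm
      simp at hm
  · have h8 : ∀ l : ((Fin d → ℕ) × ℕ) →₀ R, (l.sum fun ab r => r * monomial y u ab) =
        Finsupp.linearCombination R (monomial y u) l := fun l => by
      simp [Finsupp.linearCombination_apply]
    rw [h8, map_add, Finsupp.linearCombination_mapDomain, Finsupp.linearCombination_apply (l := a)]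
    have : f = Finsupp.linearCombination R (monomial y u) c' + r := by rw [hr]; ring
    rw [this, ← hsum]
    rfl

end CharPolyhedra
end
end
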